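/- Let 𝔤 = 𝔤(A) be a Borcherds algebra with Cartan subalgebra 𝔥 spanned by {h_i}_{i∈I}, and let ᾱ_i ∈ 𝔥* be the restricted simple roots, defined by [h, e_i] = ᾱ_i(h)e_i for h ∈ 𝔥. Let B ⊆ I be such that the ᾱ_i for i ∈ B are pairwise distinct and form a basis of the span of {ᾱ_i}_{i∈I} in 𝔥*. Then 𝔥 decomposes as the direct sum of Span{h_i}_{i∈B} and the center 𝔷 of 𝔤. -/

import Mathlib

open scoped Classical
open FreeLieAlgebra

/-- Generators `e i`, `f i`, `h i` of a Borcherds algebra. -/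
inductive BGen (I : Type*) : Type _
  | E : I → BGen I
  | F : I → BGen I
  | H : I → BGen I

/-- The defining relations of the Borcherds algebra of a symmetrized Borcherds
Cartan matrix `A` inside the free Lie algebra on the generators. -/
noncomputable def borcherdsRels {I : Type*} (A : I → I → ℝ) :
    Set (FreeLieAlgebra ℂ (BGen I)) :=
  { x | ∃ i j : I,
      x = ⁅of ℂ (BGen.H i), of ℂ (BGen.H j)⁆ ∨
      x = ⁅of ℂ (BGen.H i), of ℂ (BGen.E j)⁆ - (A i j : ℂ) • of ℂ (BGen.E j) ∨
      x = ⁅of ℂ (BGen.H i), of ℂ (BGen.F j)⁆ + (A i j : ℂ) • of ℂ (BGen.F j) ∨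
      x = ⁅of ℂ (BGen.E i), of ℂ (BGen.F j)⁆ - (if i = j then of ℂ (BGen.H i) else 0) ∨
      (∃ n : ℕ, i ≠ j ∧ 0 < A i i ∧ (n : ℝ) = 1 - 2 * A i j / A i i ∧
        (x = ((LieAlgebra.ad ℂ (FreeLieAlgebra ℂ (BGen I)) (of ℂ (BGen.E i))) ^ n)
              (of ℂ (BGen.E j)) ∨
         x = ((LieAlgebra.ad ℂ (FreeLieAlgebra ℂ (BGen I)) (of ℂ (BGen.F i))) ^ n)
              (of ℂ (BGen.F j)))) ∨
      (A i j = 0 ∧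
        (x = ⁅of ℂ (BGen.E i), of ℂ (BGen.E j)⁆ ∨
         x = ⁅of ℂ (BGen.F i), of ℂ (BGen.F j)⁆)) }

/-- The ideal of relations. -/
noncomputable def borcherdsIdeal {I : Type*} (A : I → I → ℝ) :
    LieIdeal ℂ (FreeLieAlgebra ℂ (BGen I)) :=
  LieSubmodule.lieSpan ℂ (FreeLieAlgebra ℂ (BGen I)) (borcherdsRels A)

/-- The Borcherds algebra `𝔤(A)` of a Borcherds Cartan matrix `A`. -/
noncomputable abbrev BorcherdsAlgebra {I : Type*} (A : I → I → ℝ) :=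
  FreeLieAlgebra ℂ (BGen I) ⧸ borcherdsIdeal A

/-- The generator `e i` of `𝔤(A)`. -/
noncomputable def gE {I : Type*} (A : I → I → ℝ) (i : I) : BorcherdsAlgebra A :=
  LieSubmodule.Quotient.mk' (borcherdsIdeal A) (of ℂ (BGen.E i))

/-- The generator `f i` of `𝔤(A)`. -/
noncomputable def gF {I : Type*} (A : I → I → ℝ) (i : I) : BorcherdsAlgebra A :=
  LieSubmodule.Quotient.mk' (borcherdsIdeal A) (of ℂ (BGen.F i))

/-- The generator `h i` of `𝔤(A)`. -/
noncomputable def gH {I : Type*} (A : I → I → ℝ) (i : I) : BorcherdsAlgebra A :=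
  LieSubmodule.Quotient.mk' (borcherdsIdeal A) (of ℂ (BGen.H i))


open scoped TensorProduct

namespace BorCenter

set_option linter.unusedSectionVars false

/-- Iterated brackets `[e i₁, [e i₂, … e j]]`. -/
def Ew {I L : Type*} [LieRing L] (e : I → L) : List I → I → L
  | [], j => e j
  | i :: w, j => ⁅e i, Ew e w j⁆

/-- A Lie algebra with Chevalley type generators, grading derivations and a cobracket. -/
structure Chev {I L : Type*} [LieRing L] [LieAlgebra ℂ L] (A : I → I → ℝ)
    (e f h : I → L) (d : (I → ℂ) → L →ₗ[ℂ] L) (δ : L →ₗ[ℂ] L ⊗[ℂ] L) : Prop where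
  sym : ∀ i j, A i j = A j i
  off : ∀ i j, i ≠ j → A i j ≤ 0
  hh : ∀ i j, ⁅h i, h j⁆ = 0
  he : ∀ i j, ⁅h i, e j⁆ = (A i j : ℂ) • e j
  hf : ∀ i j, ⁅h i, f j⁆ = -((A i j : ℂ) • f j)
  ef : ∀ i, ⁅e i, f i⁆ = h i
  ef_ne : ∀ i j, i ≠ j → ⁅e i, f j⁆ = 0
  ee : ∀ i j, A i j = 0 → ⁅e i, e j⁆ = 0
  ff : ∀ i j, A i j = 0 → ⁅f i, f j⁆ = 0
  d_lie : ∀ c x y, d c ⁅x, y⁆ = ⁅d c x, y⁆ + ⁅x, d c y⁆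
  d_e : ∀ c i, d c (e i) = c i • e i
  d_f : ∀ c i, d c (f i) = -(c i • f i)
  d_h : ∀ c i, d c (h i) = 0
  δ_lie : ∀ x y, δ ⁅x, y⁆ = ⁅x, δ y⁆ - ⁅y, δ x⁆
  δ_e : ∀ i, δ (e i) = h i ⊗ₜ e i - e i ⊗ₜ h i
  δ_f : ∀ i, δ (f i) = h i ⊗ₜ f i - f i ⊗ₜ h i
  δ_h : ∀ i, δ (h i) = 0
  gen : ∀ S : Submodule ℂ L, (∀ i, e i ∈ S) → (∀ i, f i ∈ S) → (∀ i, h i ∈ S) →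
    (∀ i, ∀ x ∈ S, ⁅e i, x⁆ ∈ S) → (∀ i, ∀ x ∈ S, ⁅f i, x⁆ ∈ S) →
    (∀ i, ∀ x ∈ S, ⁅h i, x⁆ ∈ S) → S = ⊤
  hne : ∀ i, (∀ k, A i k = 0) → h i ≠ 0

section
variable {I L : Type*} [LieRing L] [LieAlgebra ℂ L] {A : I → I → ℝ}
    {e f h : I → L} {d : (I → ℂ) → L →ₗ[ℂ] L} {δ : L →ₗ[ℂ] L ⊗[ℂ] L}

theorem Chev.swap (H : Chev A e f h d δ) :
    Chev A f e (fun i => -h i) (fun c => d (-c)) (-δ) where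
  sym := H.sym
  off := H.off
  hh i j := by simp [H.hh]
  he i j := by simp [H.hf]
  hf i j := by simp [H.he]
  ef i := by rw [← lie_skew, H.ef]
  ef_ne i j hij := by rw [← lie_skew, H.ef_ne j i hij.symm, neg_zero]
  ee := H.ff
  ff := H.ee
  d_lie c x y := H.d_lie _ x y
  d_e c i := by simp [H.d_f]
  d_f c i := by simp [H.d_e]
  d_h c i := by simp [H.d_h]
  δ_lie x y := by simp [H.δ_lie]; abel
  δ_e i := by simp [H.δ_f, TensorProduct.neg_tmul, TensorProduct.tmul_neg]; abel
  δ_f i := by simp [H.δ_e, TensorProduct.neg_tmul, TensorProduct.tmul_neg]; abel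
  δ_h i := by simp [H.δ_h]
  gen S h1 h2 h3 h4 h5 h6 := H.gen S h2 h1 (fun i => by simpa using h3 i) h5 h4
    (fun i x hx => by have := h6 i x hx; rwa [neg_lie, neg_mem_iff] at this)
  hne i hi := by simpa using H.hne i hi

/-- The derivation of the tensor square induced by an endomorphism. -/
noncomputable def DT (P : L →ₗ[ℂ] L) : L ⊗[ℂ] L →ₗ[ℂ] L ⊗[ℂ] L :=
  P.rTensor L + P.lTensor L

theorem DT_tmul (P : L →ₗ[ℂ] L) (x y : L) :
    DT P (x ⊗ₜ y) = P x ⊗ₜ y + x ⊗ₜ P y := by simp [DT]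

theorem DT_ad (x : L) (t : L ⊗[ℂ] L) : ⁅x, t⁆ = DT (LieAlgebra.ad ℂ L x) t := by
  induction t using TensorProduct.induction_on with
  | zero => simp
  | tmul a b => simp [DT_tmul]
  | add a b ha hb => simp [ha, hb]

theorem DT_lie (H : Chev A e f h d δ) (c : I → ℂ) (x : L) (t : L ⊗[ℂ] L) :
    DT (d c) ⁅x, t⁆ = ⁅d c x, t⁆ + ⁅x, DT (d c) t⁆ := by
  induction t using TensorProduct.induction_on with
  | zero => simp
  | tmul a b =>
    simp [DT_tmul, H.d_lie, TensorProduct.add_tmul, TensorProduct.tmul_add]; abel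
  | add a b ha hb => simp only [lie_add, map_add, ha, hb]; abel

theorem d_Ew (H : Chev A e f h d δ) (c : I → ℂ) (w : List I) (j : I) :
    d c (Ew e w j) = (((j ::ₘ (w : Multiset I)).map c).sum) • Ew e w j := by
  induction w with
  | nil => simp [Ew, H.d_e]
  | cons i w ih =>
    simp only [Ew, H.d_lie, H.d_e, ih, smul_lie, lie_smul, ← add_smul]
    congr 1
    simp; ring

/-- `ad (h i)` is one of the grading derivations. -/
theorem ad_h (H : Chev A e f h d δ) (i : I) (x : L) :
    ⁅h i, x⁆ = d (fun k => (A i k : ℂ)) x := by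
  have : LinearMap.eqLocus (LieAlgebra.ad ℂ L (h i)) (d (fun k => (A i k : ℂ))) = ⊤ := by
    apply H.gen
    · intro j; simp [H.he, H.d_e]
    · intro j; simp [H.hf, H.d_f]
    · intro j; simp [H.hh, H.d_h]
    · intro j x hx
      simp only [LinearMap.mem_eqLocus, LieAlgebra.ad_apply] at hx ⊢
      rw [leibniz_lie, H.d_lie, hx, H.he, H.d_e]
    · intro j x hx
      simp only [LinearMap.mem_eqLocus, LieAlgebra.ad_apply] at hx ⊢
      rw [leibniz_lie, H.d_lie, hx, H.hf, H.d_f]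
    · intro j x hx
      simp only [LinearMap.mem_eqLocus, LieAlgebra.ad_apply] at hx ⊢
      rw [leibniz_lie, H.d_lie, hx, H.hh, H.d_h]
  have hx : x ∈ LinearMap.eqLocus (LieAlgebra.ad ℂ L (h i)) (d (fun k => (A i k : ℂ))) := by
    rw [this]; trivial
  simpa using hx

/-- bracket after cobracket is a grading derivation -/
theorem m_δ (H : Chev A e f h d δ) (x : L) :
    LieModule.toModuleHom ℂ L L (δ x) = d (fun k => 2 * (A k k : ℂ)) x := by
  set D := d (fun k => 2 * (A k k : ℂ)) with hD
  set m := (LieModule.toModuleHom ℂ L L) with hm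
  have e1 : ∀ i, m (δ (e i)) = D (e i) := by
    intro i
    rw [H.δ_e, map_sub, hm, LieModule.toModuleHom_apply, LieModule.toModuleHom_apply,
      ← lie_skew (e i) (h i), H.he, hD, H.d_e, sub_neg_eq_add, ← two_smul ℂ, smul_smul]
  have f1 : ∀ i, m (δ (f i)) = D (f i) := by
    intro i
    rw [H.δ_f, map_sub, hm, LieModule.toModuleHom_apply, LieModule.toModuleHom_apply,
      ← lie_skew (f i) (h i), H.hf, hD, H.d_f, sub_neg_eq_add, ← two_smul ℂ, smul_neg, smul_smul]
  have h1 : ∀ i, m (δ (h i)) = D (h i) := by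
    intro i
    rw [H.δ_h, hD, H.d_h, map_zero]
  have key : ∀ y x, m (δ y) = D y → m (δ x) = D x → m (δ ⁅y, x⁆) = D ⁅y, x⁆ := by
    intro y x hy hx
    rw [H.δ_lie, map_sub, LieModuleHom.map_lie, LieModuleHom.map_lie, hx, hy, H.d_lie,
      ← lie_skew (D y) x]
    abel
  have : LinearMap.eqLocus ((m : L ⊗[ℂ] L →ₗ[ℂ] L) ∘ₗ δ) D = ⊤ := by
    apply H.gen
    · exact e1
    · exact f1
    · exact h1
    · exact fun i x hx => key _ _ (e1 i) hx
    · exact fun i x hx => key _ _ (f1 i) hx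
    · exact fun i x hx => key _ _ (h1 i) hx
  have hx : x ∈ LinearMap.eqLocus ((m : L ⊗[ℂ] L →ₗ[ℂ] L) ∘ₗ δ) D := by
    rw [this]; trivial
  exact hx

/-- words with letters in `S` -/
def WS (e : I → L) (S : Set I) : Set L :=
  {x | ∃ w j, (∀ k ∈ w, k ∈ S) ∧ j ∈ S ∧ x = Ew e w j}

/-- tensors of words with letters in `S` -/
def WW (e : I → L) (S : Set I) : Submodule ℂ (L ⊗[ℂ] L) :=
  Submodule.span ℂ {t | ∃ x ∈ WS e S, ∃ y ∈ WS e S, t = x ⊗ₜ y}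

theorem WS_lie {S : Set I} {i : I} (hi : i ∈ S) {x : L} (hx : x ∈ WS e S) :
    ⁅e i, x⁆ ∈ WS e S := by
  obtain ⟨w, j, hw, hj, rfl⟩ := hx
  exact ⟨i :: w, j, by simpa using ⟨hi, hw⟩, hj, rfl⟩

theorem WW_lie {S : Set I} {i : I} (hi : i ∈ S) {t : L ⊗[ℂ] L} (ht : t ∈ WW e S) :
    ⁅e i, t⁆ ∈ WW e S := by
  induction ht using Submodule.span_induction with
  | mem t ht =>
    obtain ⟨x, hx, y, hy, rfl⟩ := ht
    rw [TensorProduct.LieModule.lie_tmul_right]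
    exact add_mem (Submodule.subset_span ⟨_, WS_lie hi hx, y, hy, rfl⟩)
      (Submodule.subset_span ⟨x, hx, _, WS_lie hi hy, rfl⟩)
  | zero => simp
  | add a b _ _ ha hb => rw [lie_add]; exact add_mem ha hb
  | smul a b _ hb => rw [lie_smul]; exact Submodule.smul_mem _ _ hb

theorem hs_lie (H : Chev A e f h d δ) (β : Multiset I) (i : I) :
    ⁅(β.map h).sum, e i⁆ = ((β.map fun k => (A i k : ℂ)).sum) • e i := by
  induction β using Multiset.induction_on with
  | empty => simp
  | cons k β ih => simp [ih, H.he, add_smul, H.sym k i]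

theorem hs_lie_f (H : Chev A e f h d δ) (β : Multiset I) (i : I) :
    ⁅(β.map h).sum, f i⁆ = -(((β.map fun k => (A i k : ℂ)).sum) • f i) := by
  induction β using Multiset.induction_on with
  | empty => simp
  | cons k β ih => simp [ih, H.hf, add_smul, H.sym k i]; abel

theorem hs_lie_h (H : Chev A e f h d δ) (β : Multiset I) (i : I) :
    ⁅(β.map h).sum, h i⁆ = 0 := by
  induction β using Multiset.induction_on with
  | empty => simp
  | cons k β ih => simp [ih, H.hh]

theorem d_hs (H : Chev A e f h d δ) (β : Multiset I) (c : I → ℂ) :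
    d c ((β.map h).sum) = 0 := by
  induction β using Multiset.induction_on with
  | empty => simp
  | cons k β ih => simp [ih, H.d_h]

theorem δ_Ew (H : Chev A e f h d δ) (S : Set I) (w : List I) (j : I)
    (hw : ∀ k ∈ w, k ∈ S) (hj : j ∈ S) (β : Multiset I) (hβ : j ::ₘ (w : Multiset I) = β) :
    (δ (Ew e w j) - ((β.map h).sum ⊗ₜ Ew e w j - Ew e w j ⊗ₜ (β.map h).sum)) ∈ WW e S ∧
    ∀ c, DT (d c) (δ (Ew e w j) - ((β.map h).sum ⊗ₜ Ew e w j - Ew e w j ⊗ₜ (β.map h).sum)) =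
      ((β.map c).sum) •
        (δ (Ew e w j) - ((β.map h).sum ⊗ₜ Ew e w j - Ew e w j ⊗ₜ (β.map h).sum)) := by
  induction w generalizing β with
  | nil => subst hβ; simp [Ew, H.δ_e]
  | cons i w ih =>
    obtain ⟨ih1, ih2⟩ := ih (fun k hk => hw k (by simp [hk])) _ rfl
    set γ := j ::ₘ (w : Multiset I) with hγ
    have hβ' : β = i ::ₘ γ := by
      rw [← hβ, hγ, Multiset.cons_swap]; rfl
    set x := Ew e w j with hx
    set t := δ x - ((γ.map h).sum ⊗ₜ x - x ⊗ₜ (γ.map h).sum) with ht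
    set q := (γ.map fun k => (A i k : ℂ)).sum with hq
    have hi : i ∈ S := hw i (by simp)
    have hxS : x ∈ WS e S := ⟨w, j, fun k hk => hw k (by simp [hk]), hj, rfl⟩
    have heS : e i ∈ WS e S := ⟨[], i, by simp, hi, rfl⟩
    have h1 : ⁅e i, (γ.map h).sum⁆ = -(q • e i) := by
      rw [← lie_skew, hs_lie H]
    have h2 : ⁅x, h i⁆ = -(q • x) := by
      rw [← lie_skew, ad_h H, d_Ew H]
    have h3 : ⁅x, e i⁆ = - ⁅e i, x⁆ := by rw [lie_skew]
    have hδ : δ x = t + ((γ.map h).sum ⊗ₜ x - x ⊗ₜ (γ.map h).sum) := by rw [ht]; abel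
    have main : δ (Ew e (i :: w) j) - ((β.map h).sum ⊗ₜ Ew e (i :: w) j -
        Ew e (i :: w) j ⊗ₜ (β.map h).sum) =
        ⁅e i, t⁆ - (2 * q) • (e i ⊗ₜ x - x ⊗ₜ e i) := by
      simp only [Ew, ← hx, hβ', Multiset.map_cons, Multiset.sum_cons]
      rw [H.δ_lie, hδ, H.δ_e]
      simp only [lie_add, lie_sub, TensorProduct.LieModule.lie_tmul_right, h1, h2, h3,
        TensorProduct.add_tmul, TensorProduct.tmul_add, TensorProduct.neg_tmul,
        TensorProduct.tmul_neg, ← TensorProduct.smul_tmul', TensorProduct.tmul_smul]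
      module
    rw [main]
    constructor
    · refine sub_mem (WW_lie hi ih1) (Submodule.smul_mem _ _ (sub_mem ?_ ?_))
      · exact Submodule.subset_span ⟨_, heS, _, hxS, rfl⟩
      · exact Submodule.subset_span ⟨_, hxS, _, heS, rfl⟩
    · intro c
      rw [map_sub, DT_lie H, ih2 c, map_smul, map_sub, DT_tmul, DT_tmul, H.d_e, d_Ew H, hβ']
      simp only [smul_lie, lie_smul, Multiset.map_cons, Multiset.sum_cons,
        ← TensorProduct.smul_tmul', TensorProduct.tmul_smul, ← hγ]
      module

end


section
variable {I L : Type*} [LieRing L] [LieAlgebra ℂ L] {A : I → I → ℝ}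
    {e f h : I → L} {d : (I → ℂ) → L →ₗ[ℂ] L} {δ : L →ₗ[ℂ] L ⊗[ℂ] L}

theorem exists_dual (b : Set L) (hli : LinearIndependent ℂ ((↑) : b → L)) :
    ∃ φ : L → L →ₗ[ℂ] ℂ, ∀ y ∈ b, ∀ y' ∈ b, φ y y' = if y' = y then 1 else 0 := by
  let B := Module.Basis.extend (K := ℂ) (s := b) hli
  refine ⟨fun y => if hy : y ∈ b then B.coord ⟨y, Module.Basis.subset_extend hli hy⟩ else 0, ?_⟩
  intro y hy y' hy'
  simp only [hy, dite_true]
  have : y' = B ⟨y', Module.Basis.subset_extend hli hy'⟩ := by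
    exact (Module.Basis.extend_apply_self hli ⟨y', _⟩).symm
  conv_lhs => rw [this]
  rw [Module.Basis.coord_apply, Module.Basis.repr_self, Finsupp.single_apply]
  simp

theorem exists_repr (S : Set I) (t : L ⊗[ℂ] L) (ht : t ∈ WW e S) :
    ∃ (s : Finset L) (a : L → L) (φ : L → L →ₗ[ℂ] ℂ),
      (∀ y ∈ s, y ∈ WS e S) ∧ (∀ y, a y ∈ Submodule.span ℂ (WS e S)) ∧
      t = ∑ y ∈ s, a y ⊗ₜ y ∧ ∀ y ∈ s, ∀ y' ∈ s, φ y y' = if y' = y then 1 else 0 := by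
  obtain ⟨b, hb, hspan, hli⟩ := exists_linearIndependent ℂ (WS e S)
  obtain ⟨φ, hφ⟩ := exists_dual b hli
  have key : ∃ g : L →₀ L, (↑g.support ⊆ b) ∧ (∀ y, g y ∈ Submodule.span ℂ (WS e S)) ∧
      t = g.sum (fun y x => x ⊗ₜ[ℂ] y) := by
    induction ht using Submodule.span_induction with
    | zero => exact ⟨0, by simp, by simp, by simp⟩
    | add t1 t2 _ _ h1 h2 =>
      obtain ⟨g1, s1, v1, e1⟩ := h1
      obtain ⟨g2, s2, v2, e2⟩ := h2
      refine ⟨g1 + g2, ?_, fun y => ?_, ?_⟩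
      · intro y hy
        have := Finsupp.support_add hy
        rcases Finset.mem_union.1 this with h | h
        · exact s1 h
        · exact s2 h
      · exact add_mem (v1 y) (v2 y)
      · rw [Finsupp.sum_add_index', e1, e2]
        · simp
        · intro y x x'; rw [TensorProduct.add_tmul]
    | smul c t1 _ h1 =>
      obtain ⟨g1, s1, v1, e1⟩ := h1
      refine ⟨c • g1, ?_, fun y => Submodule.smul_mem _ _ (v1 y), ?_⟩
      · exact fun y hy => s1 (Finsupp.support_smul hy)
      · rw [Finsupp.sum_smul_index', e1, Finsupp.smul_sum]
        · rfl
        · simp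
    | mem t ht =>
      obtain ⟨x, hx, y, hy, rfl⟩ := ht
      have hy' : y ∈ Submodule.span ℂ b := by rw [hspan]; exact Submodule.subset_span hy
      obtain ⟨c, hc, hcy⟩ := Submodule.mem_span_set.1 hy'
      refine ⟨c.mapRange (fun r => r • x) (by simp), ?_, ?_, ?_⟩
      · exact fun y hy => hc (Finsupp.support_mapRange hy)
      · intro y
        exact Submodule.smul_mem _ _ (Submodule.subset_span hx)
      · rw [Finsupp.sum_mapRange_index (by simp), ← hcy, Finsupp.sum, Finsupp.sum,
          TensorProduct.tmul_sum]
        simp [TensorProduct.smul_tmul]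
  obtain ⟨g, hg, hv, rfl⟩ := key
  exact ⟨g.support, g, φ, fun y hy => hb (hg hy), hv, rfl,
    fun y hy y' hy' => hφ y (hg hy) y' (hg hy')⟩

theorem op_apply (s : Finset L) (a : L → L) (φ : L → L →ₗ[ℂ] ℂ) (t : L ⊗[ℂ] L)
    (ht : t = ∑ y ∈ s, a y ⊗ₜ y)
    (hφ : ∀ y ∈ s, ∀ y' ∈ s, φ y y' = if y' = y then 1 else 0)
    (P : L →ₗ[ℂ] L) (μ : ℂ) (hP : DT P t = μ • t) (y : L) (hy : y ∈ s) :
    P (a y) = μ • a y - ∑ l ∈ s, φ y (P l) • a l := by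
  let Ψ : L ⊗[ℂ] L →ₗ[ℂ] L := (TensorProduct.rid ℂ L : L ⊗[ℂ] ℂ →ₗ[ℂ] L) ∘ₗ (φ y).lTensor L
  have hΨ : ∀ u v, Ψ (u ⊗ₜ v) = φ y v • u := by intro u v; simp [Ψ]
  have h1 := congrArg Ψ hP
  rw [ht] at h1
  simp only [map_sum, DT_tmul, map_add, map_smul, hΨ, Finset.sum_add_distrib] at h1
  have h2 : ∀ g : L → L, ∑ l ∈ s, φ y l • g l = g y := by
    intro g
    rw [Finset.sum_eq_single y]
    · rw [hφ y hy y hy]; simp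
    · intro l hl hne; rw [hφ y hy l hl]; simp [hne]
    · intro h; exact absurd hy h
  rw [h2 (fun l => P (a l)), h2 a] at h1
  rw [← h1]; abel

theorem diag_trace {V : Type*} [AddCommGroup V] [Module ℂ V] [FiniteDimensional ℂ V]
    (T : Module.End ℂ V) (G : Set V) (hG : ⊤ ≤ Submodule.span ℂ G)
    (hT : ∀ g ∈ G, ∃ μ : ℝ, T g = (μ : ℂ) • g) :
    ∃ r : ℝ, 0 ≤ r ∧ LinearMap.trace ℂ V (T * T) = r ∧ (r = 0 → T = 0) := by
  let B := Module.Basis.ofSpan hG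
  have : Fintype ((linearIndepOn_empty ℂ id).extend (Set.empty_subset G) : Set V) :=
    FiniteDimensional.fintypeBasisIndex B
  have hB : ∀ i, ∃ μ : ℝ, T (B i) = (μ : ℂ) • B i := fun i =>
    hT _ (Module.Basis.ofSpan_subset hG ⟨i, rfl⟩)
  choose μ hμ using hB
  refine ⟨∑ i, μ i * μ i, Finset.sum_nonneg fun i _ => mul_self_nonneg _, ?_, ?_⟩
  · rw [LinearMap.trace_eq_matrix_trace ℂ B, Matrix.trace]
    push_cast
    refine Finset.sum_congr rfl fun i _ => ?_
    rw [Matrix.diag_apply, LinearMap.toMatrix_apply, Module.End.mul_apply, hμ, map_smul, hμ,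
      map_smul, map_smul, Module.Basis.repr_self]
    simp
  · intro h0
    rw [Finset.sum_eq_zero_iff_of_nonneg (fun i _ => mul_self_nonneg _)] at h0
    refine B.ext fun i => ?_
    have := mul_self_eq_zero.1 (h0 i (Finset.mem_univ _))
    rw [hμ, this]; simp

theorem triv_trace {V : Type*} [AddCommGroup V] [Module ℂ V] [FiniteDimensional ℂ V]
    (N : Module.End ℂ V) (E F T : I → Module.End ℂ V) (β : Multiset I)
    (hEF : ∀ k, E k * F k - F k * E k = T k)
    (hN : ∀ k, N * E k - E k * N = E k)
    (hTE : ∀ k, T k * E k - E k * T k = (A k k : ℂ) • E k)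
    (G : Set V) (hG : ⊤ ≤ Submodule.span ℂ G)
    (hT : ∀ k, ∀ g ∈ G, ∃ μ : ℝ, T k g = (μ : ℂ) • g)
    (hsum : (β.map T).sum = 0)
    (him : ∀ k ∈ β, 0 < A k k ∨ T k = 0) :
    ∀ k ∈ β, 0 < A k k → E k = 0 := by
  have c1 : ∀ k (X : Module.End ℂ V), LinearMap.trace ℂ V (X * T k) =
      LinearMap.trace ℂ V ((X * E k - E k * X) * F k) := by
    intro k X
    rw [← hEF, mul_sub, sub_mul, map_sub, map_sub, mul_assoc, ← mul_assoc X (F k),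
      LinearMap.trace_mul_comm ℂ (X * F k), mul_assoc]
  have c2 : ∀ k, LinearMap.trace ℂ V (T k * T k) =
      (A k k : ℂ) * LinearMap.trace ℂ V (N * T k) := by
    intro k
    rw [c1, c1 k N, hN, hTE, smul_mul_assoc, map_smul, smul_eq_mul]
  have c3 : ∀ k ∈ β, 0 ≤ (LinearMap.trace ℂ V (N * T k)).re ∧
      ((LinearMap.trace ℂ V (N * T k)).re = 0 → 0 < A k k → E k = 0) := by
    intro k hk
    rcases him k hk with hp | h0
    · obtain ⟨r, hr, htr, hr0⟩ := diag_trace (T k) G hG (hT k)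
      have e1 : r = A k k * (LinearMap.trace ℂ V (N * T k)).re := by
        have := congrArg Complex.re ((c2 k).symm.trans htr)
        rw [Complex.re_ofReal_mul, Complex.ofReal_re] at this
        exact this.symm
      refine ⟨?_, fun hz _ => ?_⟩
      · by_contra hneg
        push Not at hneg
        nlinarith
      · have hT0 := hr0 (by rw [e1, hz, mul_zero])
        have := hTE k
        rw [hT0, zero_mul, mul_zero, sub_zero] at this
        have hne : (A k k : ℂ) ≠ 0 := by exact_mod_cast hp.ne'
        exact (smul_eq_zero.1 this.symm).resolve_left hne
    · refine ⟨by simp [h0], fun _ hp => ?_⟩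
      have := hTE k
      rw [h0, zero_mul, mul_zero, sub_zero] at this
      have hne : (A k k : ℂ) ≠ 0 := by exact_mod_cast hp.ne'
      exact (smul_eq_zero.1 this.symm).resolve_left hne
  have c4 : (β.map fun k => (LinearMap.trace ℂ V (N * T k)).re).sum = 0 := by
    have : ∀ β : Multiset I, (β.map fun k => (LinearMap.trace ℂ V (N * T k)).re).sum =
        (LinearMap.trace ℂ V (N * (β.map T).sum)).re := by
      intro β
      induction β using Multiset.induction_on with
      | empty => simp
      | cons k β ih => simp [ih, mul_add]
    rw [this, hsum]; simp
  intro k hk hp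
  refine (c3 k hk).2 (le_antisymm ?_ (c3 k hk).1) hp
  rw [← c4]
  refine Multiset.single_le_sum ?_ _ (Multiset.mem_map_of_mem _ hk)
  intro x hx
  obtain ⟨k', hk', rfl⟩ := Multiset.mem_map.1 hx
  exact (c3 k' hk').1

end


section
variable {I L : Type*} [LieRing L] [LieAlgebra ℂ L] {A : I → I → ℝ}
    {e f h : I → L} {d : (I → ℂ) → L →ₗ[ℂ] L} {δ : L →ₗ[ℂ] L ⊗[ℂ] L}

/-- the positive homogeneous component of degree `β` -/
def NB (e : I → L) (β : Multiset I) : Submodule ℂ L :=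
  Submodule.span ℂ {x | ∃ (w : List I) (j : I), j ::ₘ (w : Multiset I) = β ∧ x = Ew e w j}

theorem d_NB (H : Chev A e f h d δ) (c : I → ℂ) (β : Multiset I) (z : L) (hz : z ∈ NB e β) :
    d c z = ((β.map c).sum) • z := by
  induction hz using Submodule.span_induction with
  | mem x hx => obtain ⟨w, j, rfl, rfl⟩ := hx; exact d_Ew H c w j
  | zero => simp
  | add x y _ _ hx hy => simp [hx, hy]
  | smul c x _ hx => rw [map_smul, hx, smul_comm]

theorem δ_NB (H : Chev A e f h d δ) (β : Multiset I) (z : L) (hz : z ∈ NB e β) :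
    (δ z - ((β.map h).sum ⊗ₜ z - z ⊗ₜ (β.map h).sum)) ∈ WW e {k | k ∈ β} ∧
    ∀ c, DT (d c) (δ z - ((β.map h).sum ⊗ₜ z - z ⊗ₜ (β.map h).sum)) =
      ((β.map c).sum) • (δ z - ((β.map h).sum ⊗ₜ z - z ⊗ₜ (β.map h).sum)) := by
  let Q : L →ₗ[ℂ] L ⊗[ℂ] L := δ - (TensorProduct.mk ℂ L L ((β.map h).sum) -
    (TensorProduct.mk ℂ L L).flip ((β.map h).sum))
  change Q z ∈ _ ∧ ∀ c, DT (d c) (Q z) = ((β.map c).sum) • Q z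
  induction hz using Submodule.span_induction with
  | mem x hx =>
    obtain ⟨w, j, hβ, rfl⟩ := hx
    refine δ_Ew H _ w j ?_ ?_ β hβ
    · intro k hk; simp [← hβ, hk]
    · simp [← hβ]
  | zero => simp
  | add x y _ _ hx hy =>
    rw [map_add]
    refine ⟨add_mem hx.1 hy.1, fun c => ?_⟩
    rw [map_add, hx.2, hy.2, smul_add]
  | smul c x _ hx =>
    rw [map_smul]
    refine ⟨Submodule.smul_mem _ _ hx.1, fun c' => ?_⟩
    rw [map_smul, hx.2, smul_comm]

/-- an element commuting with the generators is central -/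
theorem central_of (H : Chev A e f h d δ) (z : L) (h1 : ∀ i, ⁅z, e i⁆ = 0)
    (h2 : ∀ i, ⁅z, f i⁆ = 0) (h3 : ∀ i, ⁅z, h i⁆ = 0) (x : L) : ⁅z, x⁆ = 0 := by
  have : LinearMap.ker (LieAlgebra.ad ℂ L z) = ⊤ := by
    apply H.gen
    · intro i; simpa using h1 i
    · intro i; simpa using h2 i
    · intro i; simpa using h3 i
    · intro i x hx
      simp only [LinearMap.mem_ker, LieAlgebra.ad_apply] at hx ⊢
      rw [leibniz_lie, hx, h1]; simp
    · intro i x hx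
      simp only [LinearMap.mem_ker, LieAlgebra.ad_apply] at hx ⊢
      rw [leibniz_lie, hx, h2]; simp
    · intro i x hx
      simp only [LinearMap.mem_ker, LieAlgebra.ad_apply] at hx ⊢
      rw [leibniz_lie, hx, h3]; simp
  have hx : x ∈ LinearMap.ker (LieAlgebra.ad ℂ L z) := by rw [this]; trivial
  simpa using hx

theorem e_comm_WS (H : Chev A e f h d δ) (S : Set I) (i : I) (hi : ∀ k ∈ S, A i k = 0)
    (x : L) (hx : x ∈ WS e S) : ⁅e i, x⁆ = 0 := by
  obtain ⟨w, j, hw, hj, rfl⟩ := hx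
  induction w with
  | nil => exact H.ee i j (hi j hj)
  | cons k w ih =>
    rw [Ew, leibniz_lie, H.ee i k (hi k (hw k (by simp))), ih fun k hk => hw k (by simp [hk])]
    simp

theorem e_comm_span {S : Set I} (x : L) (hx : x ∈ WS e S) (v : L)
    (hv : ∀ k ∈ S, ⁅e k, v⁆ = 0) : ⁅x, v⁆ = 0 := by
  obtain ⟨w, j, hw, hj, rfl⟩ := hx
  induction w with
  | nil => exact hv j hj
  | cons k w ih =>
    rw [Ew, lie_lie, ih fun k hk => hw k (by simp [hk]), hv k (hw k (by simp))]
    simp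

theorem m_zero (H : Chev A e f h d δ) (β : Multiset I) (t : L ⊗[ℂ] L)
    (hβ0 : ∀ i, (β.map fun k => (A i k : ℂ)).sum = 0)
    (him : ∀ i ∈ β, 0 < A i i ∨ ∀ k ∈ β, A i k = 0)
    (ht : t ∈ WW e {k | k ∈ β})
    (htd : ∀ c, DT (d c) t = ((β.map c).sum) • t)
    (hinv : ∀ x : L, ⁅x, t⁆ = 0) :
    LieModule.toModuleHom ℂ L L t = 0 := by
  obtain ⟨s, a, φ, hs, ha, hts, hφ⟩ := exists_repr _ t ht
  let V : Submodule ℂ L := Submodule.span ℂ (a '' s)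
  have haV : ∀ y ∈ s, a y ∈ V := fun y hy => Submodule.subset_span ⟨y, hy, rfl⟩
  have stab : ∀ (P : L →ₗ[ℂ] L) (μ : ℂ), DT P t = μ • t → ∀ v ∈ V, P v ∈ V := by
    intro P μ hP v hv
    induction hv using Submodule.span_induction with
    | mem x hx =>
      obtain ⟨y, hy, rfl⟩ := hx
      rw [op_apply s a φ t hts hφ P μ hP y hy]
      exact sub_mem (Submodule.smul_mem _ _ (haV y hy))
        (Submodule.sum_mem _ fun l hl => Submodule.smul_mem _ _ (haV l hl))
    | zero => simp
    | add x y _ _ hx hy => rw [map_add]; exact add_mem hx hy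
    | smul c x _ hx => rw [map_smul]; exact Submodule.smul_mem _ _ hx
  have stab_ad : ∀ x : L, ∀ v ∈ V, LieAlgebra.ad ℂ L x v ∈ V := fun x =>
    stab _ 0 (by rw [← DT_ad, hinv, zero_smul])
  have stab_d : ∀ c, ∀ v ∈ V, d c v ∈ V := fun c => stab _ _ (htd c)
  have hVS : V ≤ Submodule.span ℂ (WS e {k | k ∈ β}) := by
    refine Submodule.span_le.2 ?_
    rintro _ ⟨y, _, rfl⟩
    exact ha y
  have him' : ∀ i, (∀ k ∈ β, A i k = 0) → ∀ v ∈ V, ⁅e i, v⁆ = 0 := by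
    intro i hi v hv
    have hv' := hVS hv
    clear hv
    induction hv' using Submodule.span_induction with
    | mem x hx => exact e_comm_WS H _ i hi x hx
    | zero => simp
    | add x y _ _ hx hy => rw [lie_add, hx, hy, add_zero]
    | smul c x _ hx => rw [lie_smul, hx, smul_zero]
  have hTa : ∀ k, ∀ y ∈ s, ∃ μ : ℝ, ⁅h k, a y⁆ = (μ : ℂ) • a y := by
    intro k y hy
    have h1 := op_apply s a φ t hts hφ (LieAlgebra.ad ℂ L (h k)) 0
      (by rw [← DT_ad, hinv, zero_smul]) y hy
    have h2 : ∀ l ∈ s, ∃ μ : ℝ, ⁅h k, l⁆ = (μ : ℂ) • l := by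
      intro l hl
      obtain ⟨w, j, _, _, rfl⟩ := hs l hl
      refine ⟨((j ::ₘ (w : Multiset I)).map (fun i => A k i)).sum, ?_⟩
      rw [ad_h H, d_Ew H]
      congr 1
      rw [← Complex.ofRealHom_eq_coe, map_multiset_sum, Multiset.map_map]
      rfl
    obtain ⟨μ, hμ⟩ := h2 y hy
    refine ⟨-μ, ?_⟩
    rw [LieAlgebra.ad_apply] at h1
    rw [h1, Finset.sum_eq_single y]
    · rw [LieAlgebra.ad_apply, hμ, map_smul, hφ y hy y hy]
      simp
    · intro l hl hne
      obtain ⟨ν, hν⟩ := h2 l hl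
      rw [LieAlgebra.ad_apply, hν, map_smul, hφ y hy l hl]
      simp [hne]
    · intro hn; exact absurd hy hn
  have hT0 : ∀ k, (∀ i ∈ β, A k i = 0) → ∀ v ∈ V, ⁅h k, v⁆ = 0 := by
    intro k hk v hv
    have hv' := hVS hv
    clear hv
    induction hv' using Submodule.span_induction with
    | mem x hx =>
      obtain ⟨w, j, hw, hj, rfl⟩ := hx
      rw [ad_h H, d_Ew H, Multiset.sum_eq_zero, zero_smul]
      intro r hr
      obtain ⟨i, hi, rfl⟩ := Multiset.mem_map.1 hr
      rcases Multiset.mem_cons.1 hi with rfl | hi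
      · simp [hk _ hj]
      · simp [hk _ (hw i (by simpa using hi))]
    | zero => simp
    | add x y _ _ hx hy => rw [lie_add, hx, hy, add_zero]
    | smul c x _ hx => rw [lie_smul, hx, smul_zero]
  have hfin : FiniteDimensional ℂ V :=
    FiniteDimensional.span_of_finite ℂ (s.finite_toSet.image a)
  let R : L → Module.End ℂ V := fun x => (LieAlgebra.ad ℂ L x).restrict (stab_ad x)
  let N : Module.End ℂ V := (d (fun _ => 1)).restrict (stab_d _)
  have hR : ∀ x (v : V), ((R x v : V) : L) = ⁅x, (v : L)⁆ := fun x v => rfl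
  have hN : ∀ (v : V), ((N v : V) : L) = d (fun _ => 1) (v : L) := fun v => rfl
  have hRs : ∀ γ : Multiset I, ∀ v : V,
      (((γ.map fun k => R (h k)).sum v : V) : L) = ⁅(γ.map h).sum, (v : L)⁆ := by
    intro γ v
    induction γ using Multiset.induction_on with
    | empty => simp
    | cons k γ ih => simp [ih, hR]
  have hcen : ∀ x : L, ⁅(β.map h).sum, x⁆ = 0 := central_of H _
    (fun i => by rw [hs_lie H, hβ0, zero_smul])
    (fun i => by rw [hs_lie_f H, hβ0, zero_smul, neg_zero]) (fun i => hs_lie_h H β i)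
  have hE := triv_trace (A := A) N (fun k => R (e k)) (fun k => R (f k)) (fun k => R (h k)) β
    (by
      intro k; ext v
      simp only [LinearMap.sub_apply, Module.End.mul_apply, Submodule.coe_sub, hR]
      rw [← H.ef k, lie_lie])
    (by
      intro k; ext v
      simp only [LinearMap.sub_apply, Module.End.mul_apply, Submodule.coe_sub, hR, hN]
      rw [H.d_lie, H.d_e]; simp)
    (by
      intro k; ext v
      simp only [LinearMap.sub_apply, Module.End.mul_apply, Submodule.coe_sub, hR,
        LinearMap.smul_apply, Submodule.coe_smul]
      rw [← lie_lie, H.he, smul_lie])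
    {v : V | (v : L) ∈ a '' s}
    (by
      have : {v : V | (v : L) ∈ a '' s} = ((↑) : V → L) ⁻¹' (a '' s) := rfl
      rw [this, Submodule.span_span_coe_preimage])
    (by
      rintro k v ⟨y, hy, hyv⟩
      obtain ⟨μ, hμ⟩ := hTa k y hy
      refine ⟨μ, Subtype.ext ?_⟩
      rw [hR, ← hyv, hμ, Submodule.coe_smul, hyv])
    (by
      ext v
      rw [hRs, hcen]; rfl)
    (by
      intro k hk
      rcases him k hk with hp | h0
      · exact Or.inl hp
      · refine Or.inr ?_
        ext v
        rw [hR, hT0 k h0 v v.2]; rfl)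
  have hkill : ∀ k ∈ β, ∀ v ∈ V, ⁅e k, v⁆ = 0 := by
    intro k hk v hv
    rcases him k hk with hp | h0
    · have := hE k hk hp
      have h2 := congrArg (fun X : Module.End ℂ V => ((X ⟨v, hv⟩ : V) : L)) this
      simpa [hR] using h2
    · exact him' k h0 v hv
  rw [hts, map_sum]
  refine Finset.sum_eq_zero fun y hy => ?_
  rw [LieModule.toModuleHom_apply, ← lie_skew,
    e_comm_span y (hs y hy) (a y) (fun k hk => hkill k hk _ (haV y hy)), neg_zero]

end


section
variable {I L : Type*} [LieRing L] [LieAlgebra ℂ L] {A : I → I → ℝ}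
    {e f h : I → L} {d : (I → ℂ) → L →ₗ[ℂ] L} {δ : L →ₗ[ℂ] L ⊗[ℂ] L}

theorem core (H : Chev A e f h d δ) (β : Multiset I) (z : L) (hz : z ∈ NB e β)
    (hc : ∀ x : L, ⁅x, z⁆ = 0) : z = 0 := by
  by_contra hz0
  have hβ0 : ∀ i, (β.map fun k => (A i k : ℂ)).sum = 0 := by
    intro i
    have h1 := hc (h i)
    rw [ad_h H, d_NB H _ β z hz] at h1
    exact (smul_eq_zero.1 h1).resolve_right hz0
  have hβr : ∀ i, (β.map fun k => A i k).sum = 0 := by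
    intro i
    have h1 := hβ0 i
    have h2 : (((β.map fun k => A i k).sum : ℝ) : ℂ) = 0 := by
      rw [← h1, ← Complex.ofRealHom_eq_coe, map_multiset_sum, Multiset.map_map]
      rfl
    exact_mod_cast h2
  have him : ∀ i ∈ β, 0 < A i i ∨ ∀ k ∈ β, A i k = 0 := by
    intro i hi
    by_cases hp : 0 < A i i
    · exact Or.inl hp
    · refine Or.inr fun k hk => ?_
      have hle : ∀ k, A i k ≤ 0 := by
        intro k
        by_cases hik : i = k
        · subst hik; exact not_lt.1 hp
        · exact H.off i k hik
      refine le_antisymm (hle k) ?_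
      have h1 : (β.map fun k => - A i k).sum = 0 := by
        rw [Multiset.sum_map_neg, hβr, neg_zero]
      have h2 : - A i k ≤ (β.map fun k => - A i k).sum := by
        refine Multiset.single_le_sum ?_ _ (Multiset.mem_map_of_mem (fun k => - A i k) hk)
        intro x hx
        obtain ⟨k', _, rfl⟩ := Multiset.mem_map.1 hx
        simpa using hle k'
      linarith
  have hcz : ∀ x : L, ⁅z, x⁆ = 0 := fun x => by rw [← lie_skew, hc, neg_zero]
  have hadz : ∀ t : L ⊗[ℂ] L, ⁅z, t⁆ = 0 := by
    intro t
    induction t using TensorProduct.induction_on with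
    | zero => simp
    | tmul a b => simp [hcz]
    | add a b ha hb => simp [ha, hb]
  have hcen : ∀ x : L, ⁅(β.map h).sum, x⁆ = 0 := central_of H _
    (fun i => by rw [hs_lie H, hβ0, zero_smul])
    (fun i => by rw [hs_lie_f H, hβ0, zero_smul, neg_zero]) (fun i => hs_lie_h H β i)
  have hcen' : ∀ x : L, ⁅x, (β.map h).sum⁆ = 0 := fun x => by rw [← lie_skew, hcen, neg_zero]
  by_cases hex : ∃ i ∈ β, 0 < A i i
  · obtain ⟨i, hi, hp⟩ := hex
    obtain ⟨h1, h2⟩ := δ_NB H β z hz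
    have h3 := m_zero H β _ hβ0 him h1 h2 (by
      intro x
      have h4 := H.δ_lie x z
      rw [hc, map_zero, hadz, sub_zero] at h4
      rw [lie_sub, ← h4, lie_sub, TensorProduct.LieModule.lie_tmul_right,
        TensorProduct.LieModule.lie_tmul_right, hc, hcen']
      simp)
    rw [map_sub, m_δ H, map_sub, LieModule.toModuleHom_apply, LieModule.toModuleHom_apply,
      hcen, hcz, sub_zero, sub_zero, d_NB H _ β z hz] at h3
    have h5 := (smul_eq_zero.1 h3).resolve_right hz0
    have h6 : (β.map fun k => 2 * A k k).sum = 0 := by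
      have h2 : (((β.map fun k => 2 * A k k).sum : ℝ) : ℂ) = 0 := by
        rw [← h5, ← Complex.ofRealHom_eq_coe, map_multiset_sum, Multiset.map_map]
        congr 1
        refine Multiset.map_congr rfl fun k _ => ?_
        simp
      exact_mod_cast h2
    have h7 : 2 * A i i ≤ (β.map fun k => 2 * A k k).sum := by
      refine Multiset.single_le_sum ?_ _ (Multiset.mem_map_of_mem (fun k => 2 * A k k) hi)
      intro x hx
      obtain ⟨k, hk, rfl⟩ := Multiset.mem_map.1 hx
      rcases him k hk with h | h
      · positivity
      · simp [h k hk]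
    linarith
  · push Not at hex
    have hA : ∀ i ∈ β, ∀ k ∈ β, A i k = 0 := fun i hi =>
      (him i hi).resolve_left (not_lt.2 (hex i hi))
    have hle : NB e β ≤ Submodule.span ℂ {x | ∃ j, {j} = β ∧ x = e j} := by
      refine Submodule.span_le.2 ?_
      rintro _ ⟨w, j, hβ, rfl⟩
      cases w with
      | nil => exact Submodule.subset_span ⟨j, by rw [← hβ]; rfl, rfl⟩
      | cons i w =>
        have : Ew e (i :: w) j = 0 := by
          rw [Ew]
          refine e_comm_WS H {k | k ∈ β} i (hA i (by simp [← hβ])) _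
            ⟨w, j, fun k hk => ?_, ?_, rfl⟩
          · simp [← hβ, hk]
          · simp [← hβ]
        rw [SetLike.mem_coe, this]
        exact zero_mem _
    by_cases hj : ∃ j, {j} = β
    · obtain ⟨j, rfl⟩ := hj
      have h1 : z ∈ Submodule.span ℂ {e j} := by
        refine Submodule.span_mono ?_ (hle hz)
        rintro _ ⟨k, hk, rfl⟩
        rw [Multiset.singleton_inj.1 hk]; rfl
      obtain ⟨c, rfl⟩ := Submodule.mem_span_singleton.1 h1
      have h2 := hcz (f j)
      rw [smul_lie, H.ef] at h2
      rcases smul_eq_zero.1 h2 with h3 | h3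
      · exact hz0 (by rw [h3, zero_smul])
      · refine H.hne j (fun k => ?_) h3
        rw [H.sym]
        simpa using hβr k
    · have h1 := hle hz
      have : {x | ∃ j, {j} = β ∧ x = e j} = (∅ : Set L) := by
        ext x; simp only [Set.mem_ofPred_eq, Set.mem_empty_iff_false, iff_false]
        rintro ⟨j, h, _⟩; exact hj ⟨j, h⟩
      rw [this, Submodule.span_empty] at h1
      exact hz0 h1

/-- homogeneous components of an element of a graded submodule -/
theorem comp_mem {ι : Type*} {K : Type*} (D : K → L →ₗ[ℂ] L) (W : Submodule ℂ L)
    (hW : ∀ c, ∀ x ∈ W, D c x ∈ W) (χ : ι → K → ℂ) (s : Finset ι) (x : ι → L)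
    (hx : ∀ k ∈ s, ∀ c, D c (x k) = χ k c • x k)
    (hsep : ∀ k ∈ s, ∀ l ∈ s, k ≠ l → x k ≠ 0 → x l ≠ 0 → ∃ c, χ k c ≠ χ l c)
    (hsum : ∑ k ∈ s, x k ∈ W) : ∀ k ∈ s, x k ∈ W := by
  induction s using Finset.induction_on generalizing x with
  | empty => simp
  | insert a s ha ih =>
    have hs : ∀ k ∈ s, x k ∈ W := by
      intro k hk
      by_cases hxa : x a = 0
      · refine ih x (fun k hk => hx k (Finset.mem_insert_of_mem hk))
          (fun k hk l hl => hsep k (Finset.mem_insert_of_mem hk) l (Finset.mem_insert_of_mem hl))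
          ?_ k hk
        rwa [Finset.sum_insert ha, hxa, zero_add] at hsum
      by_cases hxk : x k = 0
      · rw [hxk]; exact zero_mem _
      obtain ⟨c, hc⟩ := hsep k (Finset.mem_insert_of_mem hk) a (Finset.mem_insert_self a s)
        (by rintro rfl; exact ha hk) hxk hxa
      have h1 := ih (fun l => (χ l c - χ a c) • x l)
        (by
          intro l hl c'
          rw [map_smul, hx l (Finset.mem_insert_of_mem hl), smul_comm])
        (by
          intro l hl m hm hlm h1 h2
          exact hsep l (Finset.mem_insert_of_mem hl) m (Finset.mem_insert_of_mem hm) hlm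
            (fun h => h1 (by simp [h])) (fun h => h2 (by simp [h])))
        (by
          have h2 := sub_mem (hW c _ hsum) (Submodule.smul_mem W (χ a c) hsum)
          rw [map_sum, Finset.smul_sum, ← Finset.sum_sub_distrib, Finset.sum_insert ha,
            hx a (Finset.mem_insert_self a s), sub_self, zero_add] at h2
          convert h2 using 1
          refine Finset.sum_congr rfl fun l hl => ?_
          rw [hx l (Finset.mem_insert_of_mem hl), sub_smul])
        k hk
      exact (Submodule.smul_mem_iff W (sub_ne_zero.2 hc)).1 h1
    intro k hk
    rcases Finset.mem_insert.1 hk with rfl | hk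
    · rw [Finset.sum_insert ha] at hsum
      exact (Submodule.add_mem_iff_left W (Submodule.sum_mem _ hs)).1 hsum
    · exact hs k hk

end


section
variable {I L : Type*} [LieRing L] [LieAlgebra ℂ L] {A : I → I → ℝ}
    {e f h : I → L} {d : (I → ℂ) → L →ₗ[ℂ] L} {δ : L →ₗ[ℂ] L ⊗[ℂ] L}

/-- the span of all words -/
def Wd (e : I → L) : Submodule ℂ L := Submodule.span ℂ {x | ∃ (w : List I) (j : I), x = Ew e w j}

theorem Ew_mem (e : I → L) (w : List I) (j : I) : Ew e w j ∈ Wd e :=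
  Submodule.subset_span ⟨w, j, rfl⟩

theorem Wd_e (i : I) (x : L) (hx : x ∈ Wd e) : ⁅e i, x⁆ ∈ Wd e := by
  have : Wd e ≤ (Wd e).comap (LieAlgebra.ad ℂ L (e i)) := by
    refine Submodule.span_le.2 ?_
    rintro _ ⟨w, j, rfl⟩
    exact Ew_mem e (i :: w) j
  exact this hx

theorem Wd_h (H : Chev A e f h d δ) (i : I) (x : L) (hx : x ∈ Wd e) : ⁅h i, x⁆ ∈ Wd e := by
  have : Wd e ≤ (Wd e).comap (LieAlgebra.ad ℂ L (h i)) := by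
    refine Submodule.span_le.2 ?_
    rintro _ ⟨w, j, rfl⟩
    rw [SetLike.mem_coe, Submodule.mem_comap, LieAlgebra.ad_apply, ad_h H, d_Ew H]
    exact Submodule.smul_mem _ _ (Ew_mem e w j)
  exact this hx

theorem Sh_e (H : Chev A e f h d δ) (i : I) (x : L) (hx : x ∈ Submodule.span ℂ (Set.range h)) :
    ⁅e i, x⁆ ∈ Wd e := by
  have : Submodule.span ℂ (Set.range h) ≤ (Wd e).comap (LieAlgebra.ad ℂ L (e i)) := by
    refine Submodule.span_le.2 ?_
    rintro _ ⟨j, rfl⟩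
    rw [SetLike.mem_coe, Submodule.mem_comap, LieAlgebra.ad_apply, ← lie_skew, H.he]
    exact neg_mem (Submodule.smul_mem _ _ (Ew_mem e [] i))
  exact this hx

theorem Sh_h (H : Chev A e f h d δ) (i : I) (x : L) (hx : x ∈ Submodule.span ℂ (Set.range h)) :
    ⁅h i, x⁆ = 0 := by
  have : Submodule.span ℂ (Set.range h) ≤ LinearMap.ker (LieAlgebra.ad ℂ L (h i)) := by
    refine Submodule.span_le.2 ?_
    rintro _ ⟨j, rfl⟩
    rw [SetLike.mem_coe, LinearMap.mem_ker, LieAlgebra.ad_apply, H.hh]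
  simpa using this hx

theorem Wd_f (H : Chev A e f h d δ) (i : I) (x : L) (hx : x ∈ Wd e) :
    ⁅f i, x⁆ ∈ Submodule.span ℂ (Set.range h) ⊔ Wd e := by
  have : Wd e ≤ (Submodule.span ℂ (Set.range h) ⊔ Wd e).comap (LieAlgebra.ad ℂ L (f i)) := by
    refine Submodule.span_le.2 ?_
    rintro _ ⟨w, j, rfl⟩
    rw [SetLike.mem_coe, Submodule.mem_comap, LieAlgebra.ad_apply]
    have hbr : ∀ k, k = i ∨ ⁅f i, e k⁆ = 0 := by
      intro k
      by_cases hk : k = i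
      · exact Or.inl hk
      · right; rw [← lie_skew, H.ef_ne k i hk, neg_zero]
    have hbr' : ⁅f i, e i⁆ = - h i := by rw [← lie_skew, H.ef]
    induction w with
    | nil =>
      rw [Ew]
      rcases hbr j with rfl | hj
      · rw [hbr']
        exact Submodule.mem_sup_left (neg_mem (Submodule.subset_span ⟨j, rfl⟩))
      · rw [hj]; exact zero_mem _
    | cons k w ih =>
      rw [Ew, leibniz_lie]
      refine add_mem ?_ ?_
      · rcases hbr k with rfl | hk
        · rw [hbr', neg_lie]
          exact Submodule.mem_sup_right (neg_mem (Wd_h H _ _ (Ew_mem e w j)))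
        · rw [hk, zero_lie]; exact zero_mem _
      · obtain ⟨u, hu, v, hv, huv⟩ := Submodule.mem_sup.1 ih
        rw [← huv, lie_add]
        exact Submodule.mem_sup_right (add_mem (Sh_e H k u hu) (Wd_e k v hv))
  exact this hx

theorem span_neg_h (h : I → L) : Submodule.span ℂ (Set.range fun i => - h i) =
    Submodule.span ℂ (Set.range h) := by
  apply le_antisymm
  · refine Submodule.span_le.2 ?_
    rintro _ ⟨j, rfl⟩
    exact neg_mem (Submodule.subset_span ⟨j, rfl⟩)
  · refine Submodule.span_le.2 ?_
    rintro _ ⟨j, rfl⟩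
    rw [SetLike.mem_coe, ← neg_mem_iff]
    exact Submodule.subset_span ⟨j, rfl⟩

theorem total (H : Chev A e f h d δ) :
    (Submodule.span ℂ (Set.range h) ⊔ Wd e) ⊔ Wd f = ⊤ := by
  have hS : Submodule.span ℂ (Set.range h) ⊔ Wd f ≤
      (Submodule.span ℂ (Set.range h) ⊔ Wd e) ⊔ Wd f := sup_le_sup_right le_sup_left _
  apply H.gen
  · intro i
    exact Submodule.mem_sup_left (Submodule.mem_sup_right (Ew_mem e [] i))
  · intro i
    exact Submodule.mem_sup_right (Ew_mem f [] i)
  · intro i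
    exact Submodule.mem_sup_left (Submodule.mem_sup_left (Submodule.subset_span ⟨i, rfl⟩))
  · intro i x hx
    obtain ⟨y, hy, z, hz, rfl⟩ := Submodule.mem_sup.1 hx
    obtain ⟨u, hu, v, hv, rfl⟩ := Submodule.mem_sup.1 hy
    rw [lie_add, lie_add]
    refine add_mem (Submodule.mem_sup_left (Submodule.mem_sup_right
      (add_mem (Sh_e H i u hu) (Wd_e i v hv)))) (hS ?_)
    have := Wd_f H.swap i z hz
    rwa [span_neg_h] at this
  · intro i x hx
    obtain ⟨y, hy, z, hz, rfl⟩ := Submodule.mem_sup.1 hx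
    obtain ⟨u, hu, v, hv, rfl⟩ := Submodule.mem_sup.1 hy
    rw [lie_add, lie_add]
    have := Sh_e H.swap i u (by rwa [span_neg_h])
    exact add_mem (add_mem (Submodule.mem_sup_right this)
      (Submodule.mem_sup_left (Wd_f H i v hv))) (Submodule.mem_sup_right (Wd_e i z hz))
  · intro i x hx
    obtain ⟨y, hy, z, hz, rfl⟩ := Submodule.mem_sup.1 hx
    obtain ⟨u, hu, v, hv, rfl⟩ := Submodule.mem_sup.1 hy
    rw [lie_add, lie_add, Sh_h H i u hu, zero_add]
    have := Wd_h H.swap i z hz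
    rw [neg_lie, neg_mem_iff] at this
    exact add_mem (Submodule.mem_sup_left (Submodule.mem_sup_right (Wd_h H i v hv)))
      (Submodule.mem_sup_right this)

/-- homogeneous pieces -/
def piece (e f h : I → L) : Option (Multiset I ⊕ Multiset I) → Submodule ℂ L
  | none => Submodule.span ℂ (Set.range h)
  | some (Sum.inl β) => NB e β
  | some (Sum.inr β) => NB f β

/-- weights of the homogeneous pieces -/
def wt : Option (Multiset I ⊕ Multiset I) → (I → ℂ) → ℂ
  | none, _ => 0
  | some (Sum.inl β), c => (β.map c).sum
  | some (Sum.inr β), c => -(β.map c).sum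

theorem piece_top (H : Chev A e f h d δ) : ⨆ k, piece e f h k = ⊤ := by
  rw [eq_top_iff, ← total H]
  refine sup_le (sup_le ?_ ?_) ?_
  · exact le_iSup (piece e f h) none
  · refine Submodule.span_le.2 ?_
    rintro _ ⟨w, j, rfl⟩
    exact le_iSup (piece e f h) (some (Sum.inl (j ::ₘ (w : Multiset I))))
      (Submodule.subset_span ⟨w, j, rfl, rfl⟩)
  · refine Submodule.span_le.2 ?_
    rintro _ ⟨w, j, rfl⟩
    exact le_iSup (piece e f h) (some (Sum.inr (j ::ₘ (w : Multiset I))))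
      (Submodule.subset_span ⟨w, j, rfl, rfl⟩)

theorem piece_wt (H : Chev A e f h d δ) (k) (x : L) (hx : x ∈ piece e f h k) (c : I → ℂ) :
    d c x = wt k c • x := by
  rcases k with _ | β | β
  · rw [wt, zero_smul]
    have : Submodule.span ℂ (Set.range h) ≤ LinearMap.ker (d c) := by
      refine Submodule.span_le.2 ?_
      rintro _ ⟨j, rfl⟩
      exact H.d_h c j
    exact this hx
  · exact d_NB H c β x hx
  · have := d_NB H.swap (-c) β x hx
    rw [neg_neg] at this
    rw [this, wt]
    congr 1
    rw [← Multiset.sum_map_neg]; rfl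

theorem NB_zero (e : I → L) (x : L) (hx : x ∈ NB e 0) : x = 0 := by
  have : {x : L | ∃ (w : List I) (j : I), j ::ₘ (w : Multiset I) = 0 ∧ x = Ew e w j} = ∅ := by
    ext x
    simp
  rw [NB, this, Submodule.span_empty] at hx
  exact hx

theorem sum_ind (β : Multiset I) (i : I) :
    (β.map fun k => if k = i then (1 : ℂ) else 0).sum = β.count i := by
  induction β using Multiset.induction_on with
  | empty => simp
  | cons k β ih =>
    rw [Multiset.map_cons, Multiset.sum_cons, ih, Multiset.count_cons]
    by_cases hk : k = i
    · subst hk; simp; ring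
    · simp [hk, Ne.symm hk]

theorem sum_card (β : Multiset I) :
    (β.map fun _ => (1 : ℂ)).sum = β.card := by simp

theorem center_le (H : Chev A e f h d δ) (z : L) (hz : ∀ x : L, ⁅x, z⁆ = 0) :
    z ∈ Submodule.span ℂ (Set.range h) := by
  have hzt : z ∈ ⨆ k, piece e f h k := by rw [piece_top H]; trivial
  obtain ⟨g, hg, hgz⟩ := (Submodule.mem_iSup_iff_exists_finsupp _ _).1 hzt
  let W : Submodule ℂ L :=
    { carrier := {z | ∀ x : L, ⁅x, z⁆ = 0}
      add_mem' := fun {a b} ha hb x => by rw [lie_add, ha, hb, add_zero]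
      zero_mem' := fun x => lie_zero x
      smul_mem' := fun c a ha x => by rw [lie_smul, ha, smul_zero] }
  have hWd : ∀ c, ∀ x ∈ W, d c x ∈ W := by
    intro c x hx y
    have h1 := H.d_lie c y x
    rw [hx y, hx (d c y), map_zero, zero_add] at h1
    exact h1.symm
  have hpos : ∀ k ∈ g.support, g k ≠ 0 → ∀ β, (k = some (Sum.inl β) ∨ k = some (Sum.inr β)) →
      β ≠ 0 := by
    rintro k hk h0 β (rfl | rfl) rfl
    · exact h0 (NB_zero e _ (hg (some (Sum.inl 0))))
    · exact h0 (NB_zero f _ (hg (some (Sum.inr 0))))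
  have hcard : ∀ β : Multiset I, β ≠ 0 → (1 : ℝ) ≤ β.card := by
    intro β hβ
    exact_mod_cast Multiset.card_pos.2 hβ
  have hmem := comp_mem d W hWd wt g.support g (fun k _ c => piece_wt H k _ (hg k) c)
    (by
      intro k hk l hl hkl hk0 hl0
      by_contra hcon
      push Not at hcon
      have c1 := hcon (fun _ => 1)
      have hp := hpos k hk hk0
      have hq := hpos l hl hl0
      rcases k with _ | β | β <;> rcases l with _ | γ | γ <;> simp only [wt, sum_card] at c1
      · exact hkl rfl
      · have := hcard γ (hq γ (Or.inl rfl))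
        have c2 : (0 : ℝ) = γ.card := by exact_mod_cast c1
        linarith
      · have := hcard γ (hq γ (Or.inr rfl))
        have c2 : (0 : ℝ) = -γ.card := by exact_mod_cast c1
        linarith
      · have := hcard β (hp β (Or.inl rfl))
        have c2 : (β.card : ℝ) = 0 := by exact_mod_cast c1
        linarith
      · refine hkl ?_
        congr 2
        ext i
        have := hcon (fun k => if k = i then 1 else 0)
        simp only [wt, sum_ind] at this
        exact_mod_cast this
      · have := hcard β (hp β (Or.inl rfl))
        have := hcard γ (hq γ (Or.inr rfl))
        have c2 : (β.card : ℝ) = -γ.card := by exact_mod_cast c1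
        linarith
      · have := hcard β (hp β (Or.inr rfl))
        have c2 : -(β.card : ℝ) = 0 := by exact_mod_cast c1
        linarith
      · have := hcard β (hp β (Or.inr rfl))
        have := hcard γ (hq γ (Or.inl rfl))
        have c2 : -(β.card : ℝ) = γ.card := by exact_mod_cast c1
        linarith
      · refine hkl ?_
        congr 2
        ext i
        have := hcon (fun k => if k = i then 1 else 0)
        simp only [wt, sum_ind, neg_inj] at this
        exact_mod_cast this)
    (by
      have : ∑ k ∈ g.support, g k = z := hgz
      rw [this]; exact hz)
  have hz2 : z = ∑ k ∈ g.support, g k := hgz.symm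
  rw [hz2]
  refine Submodule.sum_mem _ fun k hk => ?_
  have hk1 := hg k
  have hk2 : ∀ x : L, ⁅x, g k⁆ = 0 := hmem k hk
  rcases k with _ | β | β
  · exact hk1
  · rw [core H β _ hk1 hk2]; exact zero_mem _
  · rw [core H.swap β _ hk1 hk2]; exact zero_mem _

end


section

attribute [local instance] LieRing.ofAssociativeRing

theorem free_top {X : Type*} (K : LieSubalgebra ℂ (FreeLieAlgebra ℂ X)) (hK : ∀ x, of ℂ x ∈ K)
    (y : FreeLieAlgebra ℂ X) : y ∈ K := by
  let g : FreeLieAlgebra ℂ X →ₗ⁅ℂ⁆ K := FreeLieAlgebra.lift ℂ (fun x => ⟨of ℂ x, hK x⟩)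
  have h1 : K.incl.comp g = LieHom.id := by
    apply FreeLieAlgebra.hom_ext
    intro x
    simp [g, FreeLieAlgebra.lift_of_apply]
  have h2 : (g y : FreeLieAlgebra ℂ X) = y := by
    have := congrArg (fun q : FreeLieAlgebra ℂ X →ₗ⁅ℂ⁆ FreeLieAlgebra ℂ X => q y) h1
    simpa using this
  rw [← h2]
  exact (g y).2

theorem exists_derivation {X L M : Type*} [LieRing L] [LieAlgebra ℂ L] [AddCommGroup M]
    [Module ℂ M] [LieRingModule L M] [LieModule ℂ L M] (π : FreeLieAlgebra ℂ X →ₗ⁅ℂ⁆ L)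
    (φ : X → M) : ∃ δ : FreeLieAlgebra ℂ X →ₗ[ℂ] M, (∀ x, δ (of ℂ x) = φ x) ∧
      ∀ x y, δ ⁅x, y⁆ = ⁅π x, δ y⁆ - ⁅π y, δ x⁆ := by
  let T : X → Module.End ℂ (M × ℂ) := fun x =>
    LinearMap.inl ℂ M ℂ ∘ₗ (LieModule.toEnd ℂ L M (π (of ℂ x)) ∘ₗ LinearMap.fst ℂ M ℂ +
      LinearMap.toSpanSingleton ℂ M (φ x) ∘ₗ LinearMap.snd ℂ M ℂ)
  let Λ : FreeLieAlgebra ℂ X →ₗ⁅ℂ⁆ Module.End ℂ (M × ℂ) := FreeLieAlgebra.lift ℂ T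
  let δ : FreeLieAlgebra ℂ X →ₗ[ℂ] M :=
    LinearMap.fst ℂ M ℂ ∘ₗ (LinearMap.applyₗ ((0, 1) : M × ℂ)) ∘ₗ
      (Λ : FreeLieAlgebra ℂ X →ₗ[ℂ] Module.End ℂ (M × ℂ))
  have hδ : ∀ y, δ y = (Λ y (0, 1)).1 := fun y => rfl
  have hT : ∀ x, Λ (of ℂ x) = T x := fun x => FreeLieAlgebra.lift_of_apply T x
  have hbr : ∀ (y z : FreeLieAlgebra ℂ X), (∀ m c, Λ y (m, c) = (⁅π y, m⁆ + c • δ y, 0)) →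
      (∀ m c, Λ z (m, c) = (⁅π z, m⁆ + c • δ z, 0)) → ∀ m c, Λ ⁅y, z⁆ (m, c) =
        (⁅π y, ⁅π z, m⁆ + c • δ z⁆ - ⁅π z, ⁅π y, m⁆ + c • δ y⁆, 0) := by
    intro y z hy hz m c
    rw [LieHom.map_lie, Ring.lie_def, LinearMap.sub_apply, Module.End.mul_apply,
      Module.End.mul_apply, hz, hy, hy, hz]
    simp
  let K : LieSubalgebra ℂ (FreeLieAlgebra ℂ X) :=
    { carrier := {y | ∀ m c, Λ y (m, c) = (⁅π y, m⁆ + c • δ y, 0)}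
      add_mem' := by
        intro y z hy hz m c
        rw [map_add, map_add, map_add, LinearMap.add_apply, hy, hz]
        simp only [Prod.mk_add_mk, add_lie, smul_add, add_zero]
        congr 1; abel
      zero_mem' := by intro m c; simp; rfl
      smul_mem' := by
        intro r y hy m c
        rw [map_smul, map_smul, map_smul, LinearMap.smul_apply, hy]
        simp only [Prod.smul_mk, smul_lie, smul_add, smul_zero, smul_comm r c]
      lie_mem' := by
        intro y z hy hz m c
        have h1 := hbr y z hy hz m c
        have h2 := hbr y z hy hz 0 1
        rw [h1, hδ ⁅y, z⁆, h2]
        simp only [lie_add, lie_smul, lie_zero, LieHom.map_lie, lie_lie, one_smul, zero_add,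
          smul_sub]
        congr 1; abel }
  have hK : ∀ y, y ∈ K := free_top K (by
    intro x m c
    rw [hδ, hT]
    simp [T])
  refine ⟨δ, fun x => ?_, fun x y => ?_⟩
  · rw [hδ, hT]; simp [T]
  · rw [hδ ⁅x, y⁆, hbr x y (hK x) (hK y) 0 1]
    simp

/-- derivations descend to the quotient by an ideal -/
theorem exists_quot_derivation {X M : Type*} (R : Set (FreeLieAlgebra ℂ X))
    (J : LieIdeal ℂ (FreeLieAlgebra ℂ X))
    (hJ : J = LieSubmodule.lieSpan ℂ (FreeLieAlgebra ℂ X) R)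
    [AddCommGroup M] [Module ℂ M]
    [LieRingModule (FreeLieAlgebra ℂ X ⧸ J) M] [LieModule ℂ (FreeLieAlgebra ℂ X ⧸ J) M]
    (π : FreeLieAlgebra ℂ X →ₗ⁅ℂ⁆ (FreeLieAlgebra ℂ X ⧸ J))
    (hπ : ∀ x, π x = LieSubmodule.Quotient.mk' J x)
    (φ : X → M)
    (hφ : ∀ δ : FreeLieAlgebra ℂ X →ₗ[ℂ] M, (∀ x, δ (of ℂ x) = φ x) →
      (∀ x y, δ ⁅x, y⁆ = ⁅π x, δ y⁆ - ⁅π y, δ x⁆) → ∀ r ∈ R, δ r = 0) :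
    ∃ δ : (FreeLieAlgebra ℂ X ⧸ J) →ₗ[ℂ] M,
      (∀ x, δ (π (of ℂ x)) = φ x) ∧ ∀ x y, δ ⁅x, y⁆ = ⁅x, δ y⁆ - ⁅y, δ x⁆ := by
  obtain ⟨δ, h1, h2⟩ := exists_derivation π φ
  have h3 := hφ δ h1 h2
  have hker : ∀ x ∈ J, π x = 0 := by
    intro x hx
    rw [hπ]
    exact (LieSubmodule.Quotient.mk_eq_zero (N := J)).2 hx
  let K : LieSubmodule ℂ (FreeLieAlgebra ℂ X) (FreeLieAlgebra ℂ X) :=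
    { (J.toSubmodule ⊓ LinearMap.ker δ) with
      lie_mem := by
        rintro x y ⟨hy1, hy2⟩
        refine ⟨J.lie_mem hy1, ?_⟩
        have hy2' : δ y = 0 := hy2
        change δ ⁅x, y⁆ = 0
        rw [h2, hy2', hker y hy1, lie_zero, zero_lie, sub_zero] }
  have hJK : J ≤ K := by
    conv_lhs => rw [hJ]
    refine LieSubmodule.lieSpan_le.2 fun r hr => ⟨?_, h3 r hr⟩
    rw [hJ]
    exact LieSubmodule.subset_lieSpan hr
  have hle : J.toSubmodule ≤ LinearMap.ker δ := fun x hx => (hJK hx).2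
  let D : (FreeLieAlgebra ℂ X ⧸ J) →ₗ[ℂ] M := J.toSubmodule.liftQ δ hle
  have hD : ∀ x, D (π x) = δ x := by
    intro x
    rw [hπ]
    exact Submodule.liftQ_apply J.toSubmodule δ x
  have hsurj : ∀ q, ∃ x, π x = q := by
    intro q
    obtain ⟨x, hx⟩ := LieSubmodule.Quotient.surjective_mk' J q
    exact ⟨x, (hπ x).trans hx⟩
  refine ⟨D, fun x => by rw [hD, h1], fun x y => ?_⟩
  obtain ⟨x, rfl⟩ := hsurj x
  obtain ⟨y, rfl⟩ := hsurj y
  rw [← LieHom.map_lie, hD, h2, hD, hD]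

end


section

/-- antisymmetric tensors -/
noncomputable def wg {L : Type*} [LieRing L] [LieAlgebra ℂ L] (x y : L) : L ⊗[ℂ] L :=
  x ⊗ₜ y - y ⊗ₜ x

theorem serre_δ {X L : Type*} [LieRing L] [LieAlgebra ℂ L] (π : FreeLieAlgebra ℂ X →ₗ⁅ℂ⁆ L)
    (δ : FreeLieAlgebra ℂ X →ₗ[ℂ] L ⊗[ℂ] L)
    (hδ : ∀ x y, δ ⁅x, y⁆ = ⁅π x, δ y⁆ - ⁅π y, δ x⁆)
    (a b : FreeLieAlgebra ℂ X) (p q : L) (α γ : ℂ)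
    (hpa : ⁅p, π a⁆ = α • π a) (hpb : ⁅p, π b⁆ = γ • π b) (hqa : ⁅q, π a⁆ = γ • π a)
    (ha : δ a = p ⊗ₜ π a - π a ⊗ₜ p) (hb : δ b = q ⊗ₜ π b - π b ⊗ₜ q)
    (n : ℕ) (hX : π (((LieAlgebra.ad ℂ (FreeLieAlgebra ℂ X) a) ^ (n + 1)) b) = 0)
    (hn : (n : ℂ) * α + 2 * γ = 0) :
    δ (((LieAlgebra.ad ℂ (FreeLieAlgebra ℂ X) a) ^ (n + 1)) b) = 0 := by
  let x : ℕ → FreeLieAlgebra ℂ X := fun n => ((LieAlgebra.ad ℂ (FreeLieAlgebra ℂ X) a) ^ n) b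
  have hx : ∀ n, x (n + 1) = ⁅a, x n⁆ := by
    intro n
    simp only [x, pow_succ', Module.End.mul_apply, LieAlgebra.ad_apply]
  have hx0 : x 0 = b := by simp [x]
  have hpx : ∀ n : ℕ, ⁅p, π (x n)⁆ = (n * α + γ) • π (x n) := by
    intro n
    induction n with
    | zero => simp [hx0, hpb]
    | succ n ih =>
      rw [hx, LieHom.map_lie, leibniz_lie, hpa, ih, smul_lie, lie_smul]
      push_cast
      module
  have step : ∀ (n : ℕ) (κ : ℂ) (Y : L), κ • ⁅π a, Y⁆ = κ • π (x n) →
      δ (x n) = wg ((n : ℂ) • p + q) (π (x n)) - κ • wg (π a) Y →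
      δ (x (n + 1)) = wg (((n + 1 : ℕ) : ℂ) • p + q) (π (x (n + 1))) -
        (κ + 2 * (n * α + γ)) • wg (π a) (π (x n)) := by
    intro n κ Y hY h1
    have h2 : ⁅π a, p⁆ = -(α • π a) := by rw [← lie_skew, hpa]
    have h3 : ⁅π a, q⁆ = -(γ • π a) := by rw [← lie_skew, hqa]
    have h4 : ⁅π (x n), p⁆ = -((n * α + γ) • π (x n)) := by rw [← lie_skew, hpx]
    have h5 : ⁅π (x n), π a⁆ = - ⁅π a, π (x n)⁆ := by rw [lie_skew]
    have h6 : ⁅π a, κ • wg (π a) Y⁆ = κ • wg (π a) (π (x n)) := by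
      simp only [wg, lie_smul, lie_sub, TensorProduct.LieModule.lie_tmul_right, lie_self,
        TensorProduct.zero_tmul, TensorProduct.tmul_zero, zero_add, add_zero, smul_sub]
      rw [← TensorProduct.tmul_smul, hY, TensorProduct.smul_tmul', hY,
        ← TensorProduct.smul_tmul', TensorProduct.tmul_smul]
    rw [hx, hδ, h1, ha, lie_sub, h6, LieHom.map_lie]
    simp only [wg, lie_add, lie_sub, lie_smul, TensorProduct.LieModule.lie_tmul_right, h2, h3, h4,
      h5, TensorProduct.add_tmul, TensorProduct.tmul_add, TensorProduct.neg_tmul,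
      TensorProduct.tmul_neg, ← TensorProduct.smul_tmul', TensorProduct.tmul_smul]
    push_cast
    module
  have main : ∀ n : ℕ, δ (x (n + 1)) = wg (((n + 1 : ℕ) : ℂ) • p + q) (π (x (n + 1))) -
        (((n : ℂ) + 1) * (n * α + 2 * γ)) • wg (π a) (π (x n)) := by
    intro n
    induction n with
    | zero =>
      have := step 0 0 0 (by simp) (by simp [hx0, hb, wg])
      rw [this]
      simp
    | succ n ih =>
      have := step (n + 1) _ _ (by rw [hx, LieHom.map_lie]) ih
      rw [this]
      push_cast
      congr 2
      ring
  change δ (x (n + 1)) = 0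
  have hX' : π (x (n + 1)) = 0 := hX
  rw [main, hX', hn]
  simp [wg]

theorem serre_d {X L : Type*} [LieRing L] [LieAlgebra ℂ L] (π : FreeLieAlgebra ℂ X →ₗ⁅ℂ⁆ L)
    (δ : FreeLieAlgebra ℂ X →ₗ[ℂ] L)
    (hδ : ∀ x y, δ ⁅x, y⁆ = ⁅π x, δ y⁆ - ⁅π y, δ x⁆)
    (a b : FreeLieAlgebra ℂ X) (α γ : ℂ) (ha : δ a = α • π a) (hb : δ b = γ • π b)
    (n : ℕ) (hX : π (((LieAlgebra.ad ℂ (FreeLieAlgebra ℂ X) a) ^ n) b) = 0) :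
    δ (((LieAlgebra.ad ℂ (FreeLieAlgebra ℂ X) a) ^ n) b) = 0 := by
  have main : ∀ n : ℕ, δ (((LieAlgebra.ad ℂ (FreeLieAlgebra ℂ X) a) ^ n) b) =
      (n * α + γ) • π (((LieAlgebra.ad ℂ (FreeLieAlgebra ℂ X) a) ^ n) b) := by
    intro n
    induction n with
    | zero => simp [hb]
    | succ n ih =>
      rw [pow_succ', Module.End.mul_apply, LieAlgebra.ad_apply, hδ, ih, ha, LieHom.map_lie,
        lie_smul, lie_smul, ← lie_skew (π a)]
      push_cast
      module
  rw [main, hX, smul_zero]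

variable {I : Type*} (A : I → I → ℝ)

/-- the quotient map as a Lie algebra homomorphism -/
noncomputable def piH : FreeLieAlgebra ℂ (BGen I) →ₗ⁅ℂ⁆ BorcherdsAlgebra A :=
  { (LieSubmodule.Quotient.mk' (borcherdsIdeal A) :
      FreeLieAlgebra ℂ (BGen I) →ₗ[ℂ] BorcherdsAlgebra A) with
    map_lie' := rfl }

theorem piH_apply (x) : piH A x = LieSubmodule.Quotient.mk' (borcherdsIdeal A) x := rfl
theorem piH_E (i : I) : piH A (of ℂ (BGen.E i)) = gE A i := rfl
theorem piH_F (i : I) : piH A (of ℂ (BGen.F i)) = gF A i := rfl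
theorem piH_H (i : I) : piH A (of ℂ (BGen.H i)) = gH A i := rfl

theorem piH_rel {x} (hx : x ∈ borcherdsRels A) : piH A x = 0 := by
  rw [piH_apply]
  exact (LieSubmodule.Quotient.mk_eq_zero (N := borcherdsIdeal A)).2
    (LieSubmodule.subset_lieSpan hx)

theorem piH_surj (q : BorcherdsAlgebra A) : ∃ x, piH A x = q :=
  LieSubmodule.Quotient.surjective_mk' (borcherdsIdeal A) q

theorem r_hh (i j : I) : ⁅gH A i, gH A j⁆ = 0 := by
  have := piH_rel A (x := ⁅of ℂ (BGen.H i), of ℂ (BGen.H j)⁆) ⟨i, j, Or.inl rfl⟩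
  rwa [LieHom.map_lie, piH_H, piH_H] at this

theorem r_he (i j : I) : ⁅gH A i, gE A j⁆ = (A i j : ℂ) • gE A j := by
  have := piH_rel A (x := ⁅of ℂ (BGen.H i), of ℂ (BGen.E j)⁆ - (A i j : ℂ) • of ℂ (BGen.E j))
    ⟨i, j, Or.inr (Or.inl rfl)⟩
  rwa [map_sub, map_smul, LieHom.map_lie, piH_H, piH_E, sub_eq_zero] at this

theorem r_hf (i j : I) : ⁅gH A i, gF A j⁆ = -((A i j : ℂ) • gF A j) := by
  have := piH_rel A (x := ⁅of ℂ (BGen.H i), of ℂ (BGen.F j)⁆ + (A i j : ℂ) • of ℂ (BGen.F j))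
    ⟨i, j, Or.inr (Or.inr (Or.inl rfl))⟩
  rwa [map_add, map_smul, LieHom.map_lie, piH_H, piH_F, ← eq_neg_iff_add_eq_zero] at this

theorem r_ef (i j : I) : ⁅gE A i, gF A j⁆ = if i = j then gH A i else 0 := by
  have := piH_rel A
    (x := ⁅of ℂ (BGen.E i), of ℂ (BGen.F j)⁆ - (if i = j then of ℂ (BGen.H i) else 0))
    ⟨i, j, Or.inr (Or.inr (Or.inr (Or.inl rfl)))⟩
  rw [map_sub, LieHom.map_lie, piH_E, piH_F, sub_eq_zero] at this
  rw [this]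
  split_ifs <;> simp [piH_H]

theorem r_ee (i j : I) (h : A i j = 0) : ⁅gE A i, gE A j⁆ = 0 := by
  have := piH_rel A (x := ⁅of ℂ (BGen.E i), of ℂ (BGen.E j)⁆)
    ⟨i, j, Or.inr (Or.inr (Or.inr (Or.inr (Or.inr ⟨h, Or.inl rfl⟩))))⟩
  rwa [LieHom.map_lie] at this

theorem r_ff (i j : I) (h : A i j = 0) : ⁅gF A i, gF A j⁆ = 0 := by
  have := piH_rel A (x := ⁅of ℂ (BGen.F i), of ℂ (BGen.F j)⁆)
    ⟨i, j, Or.inr (Or.inr (Or.inr (Or.inr (Or.inr ⟨h, Or.inr rfl⟩))))⟩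
  rwa [LieHom.map_lie] at this

theorem serre_n (hoff : ∀ i j, i ≠ j → A i j ≤ 0) (i j : I) (hij : i ≠ j) (hp : 0 < A i i)
    (n : ℕ) (hn : (n : ℝ) = 1 - 2 * A i j / A i i) :
    ∃ m, n = m + 1 ∧ (m : ℂ) * A i i + 2 * A i j = 0 := by
  have h1 : (1 : ℝ) ≤ n := by
    have : 2 * A i j / A i i ≤ 0 :=
      div_nonpos_of_nonpos_of_nonneg (by linarith [hoff i j hij]) hp.le
    rw [hn]; linarith
  have h2 : 1 ≤ n := by exact_mod_cast h1
  obtain ⟨m, rfl⟩ := Nat.exists_eq_add_of_le' h2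
  refine ⟨m, rfl, ?_⟩
  push_cast at hn
  have h3 : (m : ℝ) * A i i + 2 * A i j = 0 := by
    have : (m : ℝ) = - (2 * A i j / A i i) := by linarith
    rw [this]; field_simp; ring
  exact_mod_cast h3

theorem exists_d (c : I → ℂ) :
    ∃ d : BorcherdsAlgebra A →ₗ[ℂ] BorcherdsAlgebra A,
      (∀ i, d (gE A i) = c i • gE A i) ∧ (∀ i, d (gF A i) = -(c i • gF A i)) ∧
      (∀ i, d (gH A i) = 0) ∧ ∀ x y, d ⁅x, y⁆ = ⁅d x, y⁆ + ⁅x, d y⁆ := by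
  let φ : BGen I → BorcherdsAlgebra A := fun g => match g with
    | BGen.E i => c i • gE A i
    | BGen.F i => -(c i • gF A i)
    | BGen.H _ => 0
  obtain ⟨d, h1, h2⟩ := exists_quot_derivation (borcherdsRels A) (borcherdsIdeal A) rfl
    (piH A) (fun x => rfl) φ (by
      intro δ h1 h2 r hr
      have hE : ∀ i, δ (of ℂ (BGen.E i)) = c i • gE A i := fun i => h1 _
      have hF : ∀ i, δ (of ℂ (BGen.F i)) = -(c i • gF A i) := fun i => h1 _
      have hH : ∀ i, δ (of ℂ (BGen.H i)) = 0 := fun i => h1 _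
      have hr0 := piH_rel A hr
      obtain ⟨i, j, rfl | rfl | rfl | rfl | ⟨n, hij, hp, hn, rfl | rfl⟩ | ⟨h0, rfl | rfl⟩⟩ := hr
      · rw [h2, hH, hH]; simp
      · rw [map_sub, map_smul, h2, hH, hE, piH_H, lie_smul, r_he, lie_zero, sub_zero, smul_comm,
          sub_self]
      · rw [map_add, map_smul, h2, hH, hF, piH_H, lie_neg, lie_smul, r_hf, lie_zero, sub_zero]
        module
      · rw [map_sub, h2, hE, hF, piH_E, piH_F, lie_neg, lie_smul, lie_smul,
          ← lie_skew (gF A j), r_ef]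
        by_cases hij : i = j
        · subst hij; simp [hH]
        · simp [hij]
      · exact serre_d (piH A) δ h2 _ _ (c i) (c j) (hE i) (hE j) n hr0
      · exact serre_d (piH A) δ h2 _ _ (-c i) (-c j) (by rw [hF, neg_smul, piH_F])
          (by rw [hF, neg_smul, piH_F]) n hr0
      · rw [h2, hE, hE, piH_E, piH_E, lie_smul, lie_smul, ← lie_skew (gE A j), r_ee A i j h0]
        simp
      · rw [h2, hF, hF, piH_F, piH_F, lie_neg, lie_neg, lie_smul, lie_smul, ← lie_skew (gF A j),
          r_ff A i j h0]
        simp)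
  refine ⟨d, fun i => h1 _, fun i => h1 _, fun i => h1 _, fun x y => ?_⟩
  rw [h2, ← lie_skew (d x) y]
  abel

theorem exists_δ (hsym : ∀ i j, A i j = A j i) (hoff : ∀ i j, i ≠ j → A i j ≤ 0) :
    ∃ δ : BorcherdsAlgebra A →ₗ[ℂ] BorcherdsAlgebra A ⊗[ℂ] BorcherdsAlgebra A,
      (∀ i, δ (gE A i) = gH A i ⊗ₜ gE A i - gE A i ⊗ₜ gH A i) ∧
      (∀ i, δ (gF A i) = gH A i ⊗ₜ gF A i - gF A i ⊗ₜ gH A i) ∧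
      (∀ i, δ (gH A i) = 0) ∧ ∀ x y, δ ⁅x, y⁆ = ⁅x, δ y⁆ - ⁅y, δ x⁆ := by
  let φ : BGen I → BorcherdsAlgebra A ⊗[ℂ] BorcherdsAlgebra A := fun g => match g with
    | BGen.E i => gH A i ⊗ₜ gE A i - gE A i ⊗ₜ gH A i
    | BGen.F i => gH A i ⊗ₜ gF A i - gF A i ⊗ₜ gH A i
    | BGen.H _ => 0
  obtain ⟨d, h1, h2⟩ := exists_quot_derivation (borcherdsRels A) (borcherdsIdeal A) rfl
    (piH A) (fun x => rfl) φ (by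
      intro δ h1 h2 r hr
      have hE : ∀ i, δ (of ℂ (BGen.E i)) = gH A i ⊗ₜ gE A i - gE A i ⊗ₜ gH A i := fun i => h1 _
      have hF : ∀ i, δ (of ℂ (BGen.F i)) = gH A i ⊗ₜ gF A i - gF A i ⊗ₜ gH A i := fun i => h1 _
      have hH : ∀ i, δ (of ℂ (BGen.H i)) = 0 := fun i => h1 _
      have hr0 := piH_rel A hr
      have sE : ∀ (i j : I) (n : ℕ), piH A (((LieAlgebra.ad ℂ (FreeLieAlgebra ℂ (BGen I)) (of ℂ (BGen.E i)))
          ^ (n + 1)) (of ℂ (BGen.E j))) = 0 → (n : ℂ) * A i i + 2 * A i j = 0 →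
          δ (((LieAlgebra.ad ℂ (FreeLieAlgebra ℂ (BGen I)) (of ℂ (BGen.E i)))
          ^ (n + 1)) (of ℂ (BGen.E j))) = 0 := by
        intro i j n h3 h4
        refine serre_δ (piH A) δ h2 _ _ (gH A i) (gH A j) (A i i) (A i j) (r_he A i i)
          (r_he A i j) ?_ (hE i) (hE j) n h3 h4
        rw [hsym i j]; exact r_he A j i
      have sF : ∀ (i j : I) (n : ℕ), piH A (((LieAlgebra.ad ℂ (FreeLieAlgebra ℂ (BGen I)) (of ℂ (BGen.F i)))
          ^ (n + 1)) (of ℂ (BGen.F j))) = 0 → (n : ℂ) * A i i + 2 * A i j = 0 →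
          δ (((LieAlgebra.ad ℂ (FreeLieAlgebra ℂ (BGen I)) (of ℂ (BGen.F i)))
          ^ (n + 1)) (of ℂ (BGen.F j))) = 0 := by
        intro i j n h3 h4
        refine serre_δ (piH A) δ h2 _ _ (gH A i) (gH A j) (-A i i) (-A i j)
          ((r_hf A i i).trans (neg_smul _ _).symm)
          ((r_hf A i j).trans (neg_smul _ _).symm) ?_ (hF i) (hF j) n h3
          (by linear_combination -h4)
        rw [hsym i j]; exact (r_hf A j i).trans (neg_smul _ _).symm
      obtain ⟨i, j, rfl | rfl | rfl | rfl | ⟨n, hij, hp, hn, rfl | rfl⟩ | ⟨h0, rfl | rfl⟩⟩ := hr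
      · rw [h2, hH, hH]; simp
      · rw [map_sub, map_smul, h2, hH, hE, piH_H, lie_sub, lie_zero, sub_zero,
          TensorProduct.LieModule.lie_tmul_right, TensorProduct.LieModule.lie_tmul_right,
          r_he, r_hh]
        simp only [← TensorProduct.smul_tmul', TensorProduct.tmul_smul, TensorProduct.zero_tmul,
          TensorProduct.tmul_zero]
        module
      · rw [map_add, map_smul, h2, hH, hF, piH_H, lie_sub, lie_zero, sub_zero,
          TensorProduct.LieModule.lie_tmul_right, TensorProduct.LieModule.lie_tmul_right,
          r_hf, r_hh]
        simp only [TensorProduct.neg_tmul, TensorProduct.tmul_neg, ← TensorProduct.smul_tmul',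
          TensorProduct.tmul_smul, TensorProduct.zero_tmul, TensorProduct.tmul_zero]
        module
      · have e1 : ⁅gE A i, gH A j⁆ = -((A i j : ℂ) • gE A i) := by
          rw [← lie_skew, r_he, hsym j i]
        have e2 : ⁅gF A j, gH A i⁆ = (A i j : ℂ) • gF A j := by
          rw [← lie_skew, r_hf, neg_neg]
        have e3 : ⁅gF A j, gE A i⁆ = - ⁅gE A i, gF A j⁆ := (lie_skew _ _).symm
        have e4 : δ (if i = j then of ℂ (BGen.H i) else 0) = 0 := by
          split_ifs
          · exact hH i
          · exact map_zero _
        rw [map_sub, e4, h2, hE, hF, piH_E, piH_F]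
        simp only [lie_sub, TensorProduct.LieModule.lie_tmul_right, e1, e2, e3,
          TensorProduct.neg_tmul, TensorProduct.tmul_neg, ← TensorProduct.smul_tmul',
          TensorProduct.tmul_smul]
        by_cases hij : i = j
        · subst hij
          rw [r_ef, if_pos rfl]
          module
        · rw [r_ef, if_neg hij]
          simp only [TensorProduct.zero_tmul, TensorProduct.tmul_zero]
          module
      · obtain ⟨m, rfl, hm⟩ := serre_n A hoff i j hij hp n hn
        exact sE i j m hr0 hm
      · obtain ⟨m, rfl, hm⟩ := serre_n A hoff i j hij hp n hn
        exact sF i j m hr0 hm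
      · have := sE i j 0 (by simpa using hr0) (by simp [h0])
        simpa using this
      · have := sF i j 0 (by simpa using hr0) (by simp [h0])
        simpa using this)
  exact ⟨d, fun i => h1 _, fun i => h1 _, fun i => h1 _, h2⟩

end


section

variable {I : Type*} (A : I → I → ℝ)

attribute [local instance] LieRing.ofAssociativeRing

theorem gH_ne (hoff : ∀ i j, i ≠ j → A i j ≤ 0) (hsym : ∀ i j, A i j = A j i) (i : I)
    (hi : ∀ k, A i k = 0) : gH A i ≠ 0 := by
  let s01 : Matrix (Fin 3) (Fin 3) ℂ := Matrix.single 0 1 1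
  let s12 : Matrix (Fin 3) (Fin 3) ℂ := Matrix.single 1 2 1
  let s02 : Matrix (Fin 3) (Fin 3) ℂ := Matrix.single 0 2 1
  let T : BGen I → Matrix (Fin 3) (Fin 3) ℂ := fun g => match g with
    | BGen.E k => if k = i then s01 else 0
    | BGen.F k => if k = i then s12 else 0
    | BGen.H k => if k = i then s02 else 0
  let ψ : FreeLieAlgebra ℂ (BGen I) →ₗ⁅ℂ⁆ Matrix (Fin 3) (Fin 3) ℂ := FreeLieAlgebra.lift ℂ T
  have hE : ∀ k, ψ (of ℂ (BGen.E k)) = if k = i then s01 else 0 := fun k =>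
    FreeLieAlgebra.lift_of_apply T _
  have hF : ∀ k, ψ (of ℂ (BGen.F k)) = if k = i then s12 else 0 := fun k =>
    FreeLieAlgebra.lift_of_apply T _
  have hH : ∀ k, ψ (of ℂ (BGen.H k)) = if k = i then s02 else 0 := fun k =>
    FreeLieAlgebra.lift_of_apply T _
  have m1 : s02 * s01 = 0 := by simp [s02, s01]
  have m2 : s01 * s02 = 0 := by simp [s02, s01]
  have m3 : s02 * s12 = 0 := by simp [s02, s12]
  have m4 : s12 * s02 = 0 := by simp [s02, s12]
  have m5 : s01 * s12 = s02 := by simp [s02, s01, s12]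
  have m6 : s12 * s01 = 0 := by simp [s01, s12]
  have hpow : ∀ (a b : FreeLieAlgebra ℂ (BGen I)) (m : ℕ), ψ a = 0 →
      ψ (((LieAlgebra.ad ℂ (FreeLieAlgebra ℂ (BGen I)) a) ^ (m + 1)) b) = 0 := by
    intro a b m ha
    rw [pow_succ', Module.End.mul_apply, LieAlgebra.ad_apply, LieHom.map_lie, ha, zero_lie]
  have hrel : ∀ r ∈ borcherdsRels A, ψ r = 0 := by
    rintro r ⟨a, b, rfl | rfl | rfl | rfl | ⟨n, hij, hp, hn, rfl | rfl⟩ | ⟨h0, rfl | rfl⟩⟩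
    · rw [LieHom.map_lie, hH, hH]
      split_ifs <;> simp
    · rw [map_sub, map_smul, LieHom.map_lie, hH, hE]
      by_cases hb : b = i
      · subst hb
        rw [hsym, hi]
        split_ifs <;> simp [Ring.lie_def, m1, m2]
      · simp [hb]
    · rw [map_add, map_smul, LieHom.map_lie, hH, hF]
      by_cases hb : b = i
      · subst hb
        rw [hsym, hi]
        split_ifs <;> simp [Ring.lie_def, m3, m4]
      · simp [hb]
    · rw [map_sub, LieHom.map_lie, hE, hF]
      by_cases hab : a = b
      · subst hab
        rw [if_pos rfl, hH]
        split_ifs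
        · simp [Ring.lie_def, m5, m6]
        · simp
      · rw [if_neg hab, map_zero, sub_zero]
        by_cases ha : a = i
        · have hb : b ≠ i := fun h => hab (ha.trans h.symm)
          simp [hb]
        · simp [ha]
    · obtain ⟨m, rfl, hm⟩ := serre_n A hoff a b hij hp n hn
      refine hpow _ _ m ?_
      rw [hE, if_neg]
      rintro rfl
      exact absurd (hi a) hp.ne'
    · obtain ⟨m, rfl, hm⟩ := serre_n A hoff a b hij hp n hn
      refine hpow _ _ m ?_
      rw [hF, if_neg]
      rintro rfl
      exact absurd (hi a) hp.ne'
    · rw [LieHom.map_lie, hE, hE]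
      split_ifs <;> simp
    · rw [LieHom.map_lie, hF, hF]
      split_ifs <;> simp
  have hle : borcherdsIdeal A ≤ ψ.ker := by
    refine LieSubmodule.lieSpan_le.2 fun r hr => ?_
    exact LieHom.mem_ker.2 (hrel r hr)
  intro h0
  have h1 : of ℂ (BGen.H i) ∈ borcherdsIdeal A :=
    (LieSubmodule.Quotient.mk_eq_zero (N := borcherdsIdeal A)).1 h0
  have h2 := LieHom.mem_ker.1 (hle h1)
  rw [hH, if_pos rfl] at h2
  have h3 := congrFun (congrFun h2 0) 2
  simp [s02] at h3

theorem gen_top (S : Submodule ℂ (BorcherdsAlgebra A)) (h1 : ∀ i, gE A i ∈ S)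
    (h2 : ∀ i, gF A i ∈ S) (h3 : ∀ i, gH A i ∈ S)
    (h4 : ∀ i, ∀ x ∈ S, ⁅gE A i, x⁆ ∈ S) (h5 : ∀ i, ∀ x ∈ S, ⁅gF A i, x⁆ ∈ S)
    (h6 : ∀ i, ∀ x ∈ S, ⁅gH A i, x⁆ ∈ S) : S = ⊤ := by
  let K : LieSubalgebra ℂ (FreeLieAlgebra ℂ (BGen I)) :=
    { carrier := {y | ∀ x ∈ S, ⁅piH A y, x⁆ ∈ S}
      add_mem' := fun {a b} ha hb x hx => by
        rw [map_add, add_lie]; exact add_mem (ha x hx) (hb x hx)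
      zero_mem' := fun x hx => by rw [map_zero, zero_lie]; exact zero_mem _
      smul_mem' := fun c a ha x hx => by
        rw [map_smul, smul_lie]; exact Submodule.smul_mem _ _ (ha x hx)
      lie_mem' := fun {a b} ha hb x hx => by
        rw [LieHom.map_lie, lie_lie]
        exact sub_mem (ha _ (hb x hx)) (hb _ (ha x hx)) }
  have hK : ∀ y, ∀ x ∈ S, ⁅piH A y, x⁆ ∈ S := free_top K (by
    rintro (i | i | i)
    · exact h4 i
    · exact h5 i
    · exact h6 i)
  let K2 : LieSubalgebra ℂ (FreeLieAlgebra ℂ (BGen I)) :=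
    { carrier := {y | piH A y ∈ S}
      add_mem' := fun {a b} ha hb => by
        change piH A (a + b) ∈ S
        rw [map_add]; exact add_mem ha hb
      zero_mem' := by
        change piH A 0 ∈ S
        rw [map_zero]; exact zero_mem _
      smul_mem' := fun c a ha => by
        change piH A (c • a) ∈ S
        rw [map_smul]; exact Submodule.smul_mem _ _ ha
      lie_mem' := fun {a b} ha hb => by
        change piH A ⁅a, b⁆ ∈ S
        rw [LieHom.map_lie]
        exact hK a _ hb }
  have hK2 : ∀ y, piH A y ∈ S := free_top K2 (by
    rintro (i | i | i)
    · exact h1 i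
    · exact h2 i
    · exact h3 i)
  rw [eq_top_iff]
  intro q _
  obtain ⟨y, rfl⟩ := piH_surj A q
  exact hK2 y

theorem exists_chev (hsym : ∀ i j, A i j = A j i) (hoff : ∀ i j, i ≠ j → A i j ≤ 0) :
    ∃ d δ, Chev A (gE A) (gF A) (gH A) d δ := by
  obtain ⟨δ, d1, d2, d3, d4⟩ := exists_δ A hsym hoff
  choose d c1 c2 c3 c4 using exists_d A
  refine ⟨d, δ, ?_⟩
  exact {
    sym := hsym
    off := hoff
    hh := r_hh A
    he := r_he A
    hf := r_hf A
    ef := fun i => by rw [r_ef, if_pos rfl]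
    ef_ne := fun i j hij => by rw [r_ef, if_neg hij]
    ee := r_ee A
    ff := r_ff A
    d_lie := c4
    d_e := c1
    d_f := c2
    d_h := c3
    δ_lie := d4
    δ_e := d1
    δ_f := d2
    δ_h := d3
    gen := gen_top A
    hne := fun i hi => gH_ne A hoff hsym i hi }

end

end BorCenter

open BorCenter in
/-- Let `𝔤(A)` be the Borcherds algebra of a symmetrized Borcherds Cartan matrix
`A`, with Cartan subalgebra `𝔥` spanned by the `h i`.  The restricted simple
root `ᾱ_i ∈ 𝔥*` satisfies `ᾱ_i(h_j) = a_{ij}`, so linear relations among the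
`ᾱ_i` correspond exactly to linear relations among the rows of `A`.  If `B ⊆ I`
is such that the rows indexed by `B` are pairwise distinct and form a basis of
the span of all rows, then `𝔥` is the direct sum of `Span{h_i}_{i∈B}` and the
center `𝔷` of `𝔤(A)`. -/
theorem cartan_decomposition_center {I : Type*} (A : I → I → ℝ)
    (hsym : ∀ i j, A i j = A j i)
    (hoff : ∀ i j, i ≠ j → A i j ≤ 0)
    (hC3 : ∀ i j, 0 < A i i → ∃ n : ℤ, (n : ℝ) = 2 * A i j / A i i)
    (B : Set I)
    (hdist : Set.InjOn (fun i => (fun j => (A i j : ℂ))) B)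
    (hli : LinearIndependent ℂ (fun b : ↥B => (fun j => (A (b : I) j : ℂ))))
    (hspan : ∀ i : I, (fun j => (A i j : ℂ)) ∈
      Submodule.span ℂ {r : I → ℂ | ∃ b ∈ B, r = fun j => (A b j : ℂ)}) :
    Disjoint (Submodule.span ℂ {x | ∃ i ∈ B, x = gH A i})
        (LieAlgebra.center ℂ (BorcherdsAlgebra A)).toSubmodule ∧
      Submodule.span ℂ {x | ∃ i ∈ B, x = gH A i} ⊔
          (LieAlgebra.center ℂ (BorcherdsAlgebra A)).toSubmodule
        = Submodule.span ℂ (Set.range (gH A)) := by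
  obtain ⟨d, δ, H⟩ := exists_chev A hsym hoff
  have hcen : ∀ z, z ∈ (LieAlgebra.center ℂ (BorcherdsAlgebra A)).toSubmodule ↔
      ∀ x : BorcherdsAlgebra A, ⁅x, z⁆ = 0 := fun z => LieModule.mem_maxTrivSubmodule _ _ _ z
  constructor
  · rw [Submodule.disjoint_def]
    intro x hx hxc
    rw [hcen] at hxc
    have hset : {x | ∃ i ∈ B, x = gH A i} = Set.range (fun b : B => gH A b) := by
      ext y
      constructor
      · rintro ⟨i, hi, rfl⟩; exact ⟨⟨i, hi⟩, rfl⟩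
      · rintro ⟨b, rfl⟩; exact ⟨b, b.2, rfl⟩
    rw [hset] at hx
    obtain ⟨c, hc⟩ := (Finsupp.mem_span_range_iff_exists_finsupp).1 hx
    have he0 : ∀ k, gE A k = 0 → gH A k = 0 := by
      intro k hk
      rw [← H.ef k, hk, zero_lie]
    let c' : B →₀ ℂ := c.filter (fun b => gE A b ≠ 0)
    have hx' : x = ∑ b ∈ c.support, c' b • gH A b := by
      rw [← hc, Finsupp.sum]
      refine Finset.sum_congr rfl fun b _ => ?_
      by_cases hb : gE A b = 0
      · rw [he0 b hb, smul_zero, smul_zero]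
      · simp only [c']
        rw [Finsupp.filter_apply_pos (fun b : B => gE A b ≠ 0) c hb]
    have hrow : ∀ k, ∑ b ∈ c.support, c' b * (A b k : ℂ) = 0 := by
      intro k
      by_cases hk : gE A k = 0
      · refine Finset.sum_eq_zero fun b _ => ?_
        by_cases hb : gE A b = 0
        · have : c' b = 0 := Finsupp.filter_apply_neg (fun b : B => gE A b ≠ 0) c (by simpa using hb)
          rw [this, zero_mul]
        · have h1 := H.he k b
          rw [he0 k hk, zero_lie] at h1
          have h2 := (smul_eq_zero.1 h1.symm).resolve_right hb
          rw [hsym, h2, mul_zero]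
      · have h1 : ⁅x, gE A k⁆ = 0 := by rw [← lie_skew, hxc, neg_zero]
        rw [hx', sum_lie] at h1
        simp only [smul_lie, H.he, smul_smul] at h1
        rw [← Finset.sum_smul] at h1
        exact (smul_eq_zero.1 h1).resolve_right hk
    have hc0 : ∀ b ∈ c.support, c' b = 0 := by
      refine (linearIndependent_iff'.1 hli) c.support (fun b => c' b) ?_
      funext k
      rw [Finset.sum_apply]
      simpa using hrow k
    rw [hx']
    exact Finset.sum_eq_zero fun b hb => by rw [hc0 b hb, zero_smul]
  · apply le_antisymm
    · refine sup_le (Submodule.span_mono ?_) ?_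
      · rintro _ ⟨i, _, rfl⟩; exact ⟨i, rfl⟩
      · intro z hz
        exact center_le H z ((hcen z).1 hz)
    · refine Submodule.span_le.2 ?_
      rintro _ ⟨i, rfl⟩
      have key : ∀ r ∈ Submodule.span ℂ {r : I → ℂ | ∃ b ∈ B, r = fun j => (A b j : ℂ)},
          ∃ y ∈ Submodule.span ℂ {x | ∃ i ∈ B, x = gH A i},
            (∀ j, ⁅y, gE A j⁆ = r j • gE A j) ∧ (∀ j, ⁅y, gF A j⁆ = -(r j • gF A j)) ∧
            (∀ j, ⁅y, gH A j⁆ = 0) := by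
        intro r hr
        induction hr using Submodule.span_induction with
        | mem r hr =>
          obtain ⟨b, hb, rfl⟩ := hr
          exact ⟨gH A b, Submodule.subset_span ⟨b, hb, rfl⟩, H.he b, H.hf b, H.hh b⟩
        | zero => exact ⟨0, zero_mem _, by simp, by simp, by simp⟩
        | add r s _ _ h1 h2 =>
          obtain ⟨y, hy, y1, y2, y3⟩ := h1
          obtain ⟨z, hz, z1, z2, z3⟩ := h2
          refine ⟨y + z, add_mem hy hz, fun j => ?_, fun j => ?_, fun j => ?_⟩
          · rw [add_lie, y1, z1, Pi.add_apply, add_smul]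
          · rw [add_lie, y2, z2, Pi.add_apply, add_smul, neg_add]
          · rw [add_lie, y3, z3, add_zero]
        | smul c r _ h1 =>
          obtain ⟨y, hy, y1, y2, y3⟩ := h1
          refine ⟨c • y, Submodule.smul_mem _ _ hy, fun j => ?_, fun j => ?_, fun j => ?_⟩
          · rw [smul_lie, y1, Pi.smul_apply, smul_eq_mul, mul_smul]
          · rw [smul_lie, y2, Pi.smul_apply, smul_eq_mul, mul_smul, smul_neg]
          · rw [smul_lie, y3, smul_zero]
      obtain ⟨y, hy, y1, y2, y3⟩ := key _ (hspan i)
      have hz : gH A i - y ∈ (LieAlgebra.center ℂ (BorcherdsAlgebra A)).toSubmodule := by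
        rw [hcen]
        intro x
        rw [← lie_skew, central_of H (gH A i - y), neg_zero]
        · intro j; rw [sub_lie, H.he, y1, sub_self]
        · intro j; rw [sub_lie, H.hf, y2, sub_self]
        · intro j; rw [sub_lie, H.hh, y3, sub_self]
      have : gH A i = y + (gH A i - y) := by abel
      rw [SetLike.mem_coe, this]
      exact Submodule.add_mem_sup hy hz
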